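/- Let 0 < s < 1/2. For every φ ∈ S(ℝ) and every 0 < T < 1, the free evolution satisfies ‖V(t)φ‖_{X^s_T} ≲ ‖φ‖_{H^s(ℝ)}, with implicit constant depending only on s. -/

import Mathlib

open MeasureTheory Real Set Filter
open scoped FourierTransform ENNReal NNReal Topology

noncomputable section

/-- Fourier multiplier operator with symbol `m`. -/
def FMul (m : ℝ → ℂ) (f : ℝ → ℂ) : ℝ → ℂ :=
  𝓕⁻ fun ξ => m ξ * 𝓕 f ξ

/-- `D_x^α`, the Fourier multiplier with symbol `|ξ|^α`. -/
def Dop (α : ℝ) (f : ℝ → ℂ) : ℝ → ℂ :=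
  FMul (fun ξ => ((|ξ| ^ α : ℝ) : ℂ)) f

/-- The free Benjamin–Ono group `V(t) = 𝓕⁻¹ e^{itξ|ξ|} 𝓕`. -/
def BOGroup (t : ℝ) (f : ℝ → ℂ) : ℝ → ℂ :=
  FMul (fun ξ => Complex.exp (Complex.I * (t * ξ * |ξ|))) f

/-- The derivative `∂ₓ` as the Fourier multiplier with symbol `iξ`. -/
def Dx1 (f : ℝ → ℂ) : ℝ → ℂ :=
  FMul (fun ξ => Complex.I * ξ) f

/-- Projection on nonnegative frequencies. -/
def Pplus (f : ℝ → ℂ) : ℝ → ℂ :=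
  FMul (fun ξ => if 0 ≤ ξ then 1 else 0) f

/-- Projection on nonpositive frequencies. -/
def Pminus (f : ℝ → ℂ) : ℝ → ℂ :=
  FMul (fun ξ => if ξ ≤ 0 then 1 else 0) f

/-- The Sobolev `H^s` norm. -/
def HsNorm (s : ℝ) (f : ℝ → ℂ) : ℝ≥0∞ :=
  eLpNorm (fun ξ => (((1 + ξ ^ 2) ^ (s / 2) : ℝ) : ℂ) * 𝓕 f ξ) 2 volume

/-- The mixed space-time norm `L^p_x L^q_T`. -/
def LpLq (p q : ℝ≥0∞) (T : ℝ) (f : ℝ → ℝ → ℂ) : ℝ≥0∞ :=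
  eLpNorm (fun x => (eLpNorm (fun t => f x t) q (volume.restrict (Ioc (0:ℝ) T))).toReal) p volume

/-- The mixed space-time norm `L^q_T L^p_x`. -/
def LqLp (q p : ℝ≥0∞) (T : ℝ) (f : ℝ → ℝ → ℂ) : ℝ≥0∞ :=
  eLpNorm (fun t => (eLpNorm (fun x => f x t) p volume).toReal) q (volume.restrict (Ioc (0:ℝ) T))

/-- The norm `L^∞_T H^s_x`. -/
def LinfHs (s : ℝ) (T : ℝ) (f : ℝ → ℝ → ℂ) : ℝ≥0∞ :=
  eLpNorm (fun t => (HsNorm s (fun x => f x t)).toReal) ∞ (volume.restrict (Ioc (0:ℝ) T))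

/-- Apply a spatial operator slice-wise in time. -/
def sliceOp (A : (ℝ → ℂ) → (ℝ → ℂ)) (f : ℝ → ℝ → ℂ) : ℝ → ℝ → ℂ :=
  fun x t => A (fun y => f y t) x

/-- A smooth nonnegative bump `η` supported in `{1/2 ≤ |ξ| ≤ 2}` giving a dyadic
partition of unity `Σ_k η(2^{-k} ξ) = 1` for `ξ ≠ 0`. -/
structure IsLPBump (η : ℝ → ℝ) : Prop where
  smooth : ContDiff ℝ (⊤ : ℕ∞) η
  nonneg : ∀ ξ, 0 ≤ η ξ
  support : ∀ ξ, η ξ ≠ 0 → 1/2 ≤ |ξ| ∧ |ξ| ≤ 2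
  partition : ∀ ξ : ℝ, ξ ≠ 0 → ∑' k : ℤ, η ((2:ℝ) ^ (-k) * ξ) = 1

/-- The low-frequency symbol `p(ξ) = Σ_{j ≤ -3} η(2^{-j} ξ)`. -/
def lowSymbol (η : ℝ → ℝ) (ξ : ℝ) : ℝ :=
  ∑' j : ℤ, if j ≤ -3 then η ((2:ℝ) ^ (-j) * ξ) else 0

/-- The low-frequency projection `P₀`. -/
def P0 (η : ℝ → ℝ) (f : ℝ → ℂ) : ℝ → ℂ :=
  FMul (fun ξ => ((lowSymbol η ξ : ℝ) : ℂ)) f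

/-- The `X^s_T` norm. -/
def XNorm (η : ℝ → ℝ) (s T : ℝ) (u : ℝ → ℝ → ℂ) : ℝ≥0∞ :=
  LinfHs s T u + LpLq ∞ 2 T (sliceOp (Dop (s + 1/2)) u)
    + LpLq 4 ∞ T (sliceOp (Dop (s - 1/4)) u)
    + LpLq 2 ∞ T (sliceOp (P0 η) u)

/-- The Duhamel integral `∫₀ᵗ V(t-τ) f(τ) dτ`. -/
def duhamel (f : ℝ → ℝ → ℂ) : ℝ → ℝ → ℂ :=
  fun x t => ∫ τ in Ioc (0:ℝ) t, BOGroup (t - τ) (fun y => f y τ) x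

/-- The modulus of the Fourier integral `∫ e^{-(l - ib)ξ² + iaξ} dξ`. -/
def gaussKernel (l a b : ℝ) : ℝ :=
  √π * (l ^ 2 + b ^ 2) ^ (-(1 / 4) : ℝ) * rexp (-(l * a ^ 2) / (4 * (l ^ 2 + b ^ 2)))

lemma norm_integral_gaussian_phase {l : ℝ} (hl : 0 < l) (a b : ℝ) :
    ‖∫ ξ : ℝ, (rexp (-l * ξ ^ 2) : ℂ) * Complex.exp (Complex.I * ((ξ * a + ξ ^ 2 * b : ℝ) : ℂ))‖
      = gaussKernel l a b := by
  have hre : (-(l : ℂ) + Complex.I * b).re < 0 := by simp [hl]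
  have hq : 0 < l ^ 2 + b ^ 2 := by positivity
  have h := integral_cexp_quadratic hre (Complex.I * a) 0
  have h1 : (fun ξ : ℝ => (rexp (-l * ξ ^ 2) : ℂ) *
      Complex.exp (Complex.I * ((ξ * a + ξ ^ 2 * b : ℝ) : ℂ)))
      = fun ξ : ℝ => Complex.exp ((-(l : ℂ) + Complex.I * b) * ξ ^ 2 + Complex.I * a * ξ + 0) := by
    funext ξ
    push_cast
    rw [← Complex.exp_add]
    congr 1
    ring
  rw [h1, h, norm_mul, Complex.norm_exp, gaussKernel]
  have h2 : ‖((π : ℂ) / -(-(l : ℂ) + Complex.I * b)) ^ (1 / 2 : ℂ)‖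
      = √π * (l ^ 2 + b ^ 2) ^ (-(1 / 4) : ℝ) := by
    have : (1 / 2 : ℂ) = ((1 / 2 : ℝ) : ℂ) := by push_cast; rfl
    rw [this, Complex.norm_cpow_real, norm_div]
    have h3 : ‖-(-(l : ℂ) + Complex.I * b)‖ = (l ^ 2 + b ^ 2) ^ (1 / 2 : ℝ) := by
      rw [norm_neg, Complex.norm_eq_sqrt_sq_add_sq, Real.sqrt_eq_rpow]
      simp
    rw [h3, Complex.norm_real, Real.norm_of_nonneg pi_pos.le, Real.div_rpow pi_pos.le (by positivity),
      ← Real.rpow_mul hq.le, Real.sqrt_eq_rpow, div_eq_mul_inv, ← Real.rpow_neg hq.le]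
    norm_num
  rw [h2]
  congr 2
  have hne : (-(l : ℂ) + Complex.I * b) ≠ 0 := by
    intro h0
    rw [h0] at hre
    simp at hre
  have hqc : ((l : ℂ) ^ 2 + (b : ℂ) ^ 2) ≠ 0 := by exact_mod_cast hq.ne'
  have h4 : (0 - (Complex.I * a) ^ 2 / (4 * (-(l : ℂ) + Complex.I * b)))
      = ((-(l * a ^ 2) / (4 * (l ^ 2 + b ^ 2)) : ℝ) : ℂ)
        + ((-(b * a ^ 2) / (4 * (l ^ 2 + b ^ 2)) : ℝ) : ℂ) * Complex.I := by
    push_cast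
    field_simp
    linear_combination (-(a : ℂ) ^ 2 * b ^ 2 - a ^ 2 * l ^ 2 + a ^ 2 * b ^ 2) * Complex.I_sq
  rw [h4]
  simp only [Complex.add_re, Complex.ofReal_re, Complex.re_ofReal_mul, Complex.I_re, mul_zero,
    add_zero]

lemma lintegral_gaussian_mul_enorm_sq_le {X : Type*} [MeasurableSpace X] {μ : Measure X}
    [SFinite μ] {G : X → ℂ} (hG : Integrable G μ)
    {α β : X → ℝ} (hα : Measurable α) (hβ : Measurable β) {l : ℝ} (hl : 0 < l) :
    ∫⁻ ξ : ℝ, ENNReal.ofReal (rexp (-l * ξ ^ 2)) *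
        ‖∫ x, Complex.exp (Complex.I * ((ξ * α x + ξ ^ 2 * β x : ℝ) : ℂ)) * G x ∂μ‖ₑ ^ 2
      ≤ ∫⁻ x, ∫⁻ y, ‖G x‖ₑ * ‖G y‖ₑ *
          ENNReal.ofReal (gaussKernel l (α x - α y) (β x - β y)) ∂μ ∂μ := by
  set e : ℝ → X → ℂ := fun ξ x => Complex.exp (Complex.I * ((ξ * α x + ξ ^ 2 * β x : ℝ) : ℂ)) with he
  have hen : ∀ ξ x, ‖e ξ x‖ = 1 := fun ξ x => Complex.norm_exp_I_mul_ofReal _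
  set S : ℝ → ℂ := fun ξ => ∫ x, e ξ x * G x ∂μ with hS
  have hemeas : Measurable (Function.uncurry e) := by
    simp only [he, Function.uncurry_def]
    fun_prop
  -- the full integrand
  set F : ℝ → X × X → ℂ := fun ξ z =>
    (rexp (-l * ξ ^ 2) : ℂ) * ((e ξ z.1 * G z.1) * starRingEnd ℂ (e ξ z.2 * G z.2)) with hF
  have hgauss : Integrable (fun ξ : ℝ => rexp (-l * ξ ^ 2)) := integrable_exp_neg_mul_sq hl
  have hGG : Integrable (fun z : X × X => G z.1 * starRingEnd ℂ (G z.2)) (μ.prod μ) :=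
    hG.mul_prod (Complex.conjCLE.toContinuousLinearMap.integrable_comp hG)
  have hFint : Integrable (Function.uncurry F) (volume.prod (μ.prod μ)) := by
    have h0 : Integrable (fun p : ℝ × X × X => (rexp (-l * p.1 ^ 2) : ℂ) *
        (G p.2.1 * starRingEnd ℂ (G p.2.2))) (volume.prod (μ.prod μ)) :=
      (hgauss.ofReal (𝕜 := ℂ)).mul_prod hGG
    have hm : Measurable fun p : ℝ × X × X => e p.1 p.2.1 * starRingEnd ℂ (e p.1 p.2.2) := by
      have h1 : Measurable fun p : ℝ × X × X => e p.1 p.2.1 :=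
        hemeas.comp (measurable_fst.prodMk measurable_snd.fst)
      have h2 : Measurable fun p : ℝ × X × X => e p.1 p.2.2 :=
        hemeas.comp (measurable_fst.prodMk measurable_snd.snd)
      exact h1.mul (Complex.continuous_conj.measurable.comp h2)
    refine (h0.bdd_mul (c := 1) hm.aestronglyMeasurable (ae_of_all _ fun p => ?_)).congr
      (ae_of_all _ fun p => ?_)
    · simp [hen]
    · simp only [hF, Function.uncurry_def, map_mul]
      ring
  have hinner : ∀ ξ, ∫ z, F ξ z ∂(μ.prod μ) = ((rexp (-l * ξ ^ 2) * ‖S ξ‖ ^ 2 : ℝ) : ℂ) := by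
    intro ξ
    simp only [hF]
    rw [integral_const_mul, integral_prod_mul (fun x => e ξ x * G x)
      (fun y => starRingEnd ℂ (e ξ y * G y)), integral_conj, Complex.mul_conj']
    push_cast
    rfl
  have hSint : Integrable (fun ξ => rexp (-l * ξ ^ 2) * ‖S ξ‖ ^ 2) := by
    have := hFint.integral_prod_left
    simp only [Function.uncurry_def] at this
    simp_rw [hinner] at this
    exact this.re
  have hLHS : ∫⁻ ξ : ℝ, ENNReal.ofReal (rexp (-l * ξ ^ 2)) * ‖S ξ‖ₑ ^ 2
      = ‖∫ ξ, ∫ z, F ξ z ∂(μ.prod μ)‖ₑ := by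
    simp_rw [hinner]
    rw [integral_complex_ofReal, ← ofReal_norm, Complex.norm_real,
      Real.norm_of_nonneg (integral_nonneg fun ξ => by positivity),
      ofReal_integral_eq_lintegral_ofReal hSint (ae_of_all _ fun ξ => by positivity)]
    refine lintegral_congr fun ξ => ?_
    rw [ENNReal.ofReal_mul (by positivity), ENNReal.ofReal_pow (by positivity),
      ofReal_norm]
  have hkernel : ∀ z : X × X, ∫ ξ, F ξ z = (G z.1 * starRingEnd ℂ (G z.2)) *
      ∫ ξ : ℝ, (rexp (-l * ξ ^ 2) : ℂ) * Complex.exp (Complex.I *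
        ((ξ * (α z.1 - α z.2) + ξ ^ 2 * (β z.1 - β z.2) : ℝ) : ℂ)) := by
    intro z
    rw [← integral_const_mul]
    congr 1
    funext ξ
    have : e ξ z.1 * starRingEnd ℂ (e ξ z.2) = Complex.exp (Complex.I *
        ((ξ * (α z.1 - α z.2) + ξ ^ 2 * (β z.1 - β z.2) : ℝ) : ℂ)) := by
      simp only [he, ← Complex.exp_conj, ← Complex.exp_add, map_mul, Complex.conj_I,
        Complex.conj_ofReal]
      congr 1
      push_cast
      ring
    simp only [hF, map_mul, ← this]
    ring
  calc _ = ‖∫ ξ, ∫ z, F ξ z ∂(μ.prod μ)‖ₑ := hLHS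
    _ = ‖∫ z, (∫ ξ : ℝ, F ξ z) ∂(μ.prod μ)‖ₑ := by rw [integral_integral_swap hFint]
    _ ≤ ∫⁻ z, ‖∫ ξ : ℝ, F ξ z‖ₑ ∂(μ.prod μ) := enorm_integral_le_lintegral_enorm _
    _ ≤ ∫⁻ x, ∫⁻ y, ‖∫ ξ, F ξ (x, y)‖ₑ ∂μ ∂μ := lintegral_prod_le _
    _ = _ := by
      refine lintegral_congr fun x => lintegral_congr fun y => ?_
      rw [hkernel, enorm_mul, enorm_mul]
      congr 1
      · simp only [← ofReal_norm, RCLike.norm_conj]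
      · rw [← ofReal_norm, norm_integral_gaussian_phase hl]

lemma lintegral_comp_abs_eq (g : ℝ → ℝ≥0∞) :
    ∫⁻ z : ℝ, g |z| = 2 * ∫⁻ z in Ioi (0 : ℝ), g z := by
  have h1 : ∫⁻ z in Ioi (0 : ℝ), g |z| = ∫⁻ z in Ioi (0 : ℝ), g z :=
    setLIntegral_congr_fun measurableSet_Ioi fun z hz => by rw [abs_of_pos hz]
  have h2 : ∫⁻ z in Iic (0 : ℝ), g |z| = ∫⁻ z in Ioi (0 : ℝ), g z := by
    rw [← setLIntegral_congr (Iio_ae_eq_Iic (a := (0 : ℝ)) (μ := volume)), ← h1,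
      ← lintegral_indicator measurableSet_Iio, ← lintegral_indicator measurableSet_Ioi,
      ← lintegral_neg_eq_self]
    refine lintegral_congr fun z => ?_
    by_cases hz : 0 < z <;> simp [indicator, hz]
  rw [← lintegral_add_compl _ (measurableSet_Ioi (a := (0 : ℝ))), compl_Ioi, h1, h2, two_mul]

/-- The kernel `|z|^{-1/2}`, infinite at the origin. -/
def rieszKernel (z : ℝ) : ℝ≥0∞ := ENNReal.ofReal |z| ^ (-(1 / 2) : ℝ)

@[fun_prop]
lemma measurable_rieszKernel : Measurable rieszKernel := by
  unfold rieszKernel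
  fun_prop

lemma rieszKernel_neg (z : ℝ) : rieszKernel (-z) = rieszKernel z := by simp [rieszKernel]

lemma setLIntegral_rieszKernel_le {r : ℝ} (hr : 0 < r) :
    ∫⁻ z : ℝ, {z | |z| ≤ r}.indicator rieszKernel z ≤ ENNReal.ofReal (4 * r ^ (1 / 2 : ℝ)) := by
  have h0 : ∀ z : ℝ, {z | |z| ≤ r}.indicator rieszKernel z =
      (Iic r).indicator (fun y => ENNReal.ofReal y ^ (-(1 / 2) : ℝ)) |z| := fun z => by
    simp [indicator, rieszKernel]
  simp_rw [h0]
  rw [lintegral_comp_abs_eq,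
    setLIntegral_indicator measurableSet_Iic, inter_comm, Ioi_inter_Iic]
  have h1 : ∫⁻ z in Ioc 0 r, ENNReal.ofReal z ^ (-(1 / 2) : ℝ)
      = ∫⁻ z in Ioc 0 r, ENNReal.ofReal (z ^ (-(1 / 2) : ℝ)) :=
    setLIntegral_congr_fun measurableSet_Ioc fun z hz => ENNReal.ofReal_rpow_of_pos hz.1
  have h2 : IntervalIntegrable (fun z : ℝ => z ^ (-(1 / 2) : ℝ)) volume 0 r :=
    intervalIntegral.intervalIntegrable_rpow' (by norm_num)
  rw [h1, ← ofReal_integral_eq_lintegral_ofReal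
      ((intervalIntegrable_iff_integrableOn_Ioc_of_le hr.le).1 h2)
      ((ae_restrict_iff' measurableSet_Ioc).2 (ae_of_all _ fun z hz => Real.rpow_nonneg hz.1.le _)),
    ← intervalIntegral.integral_of_le hr.le, integral_rpow (Or.inl (by norm_num)),
    ← ENNReal.ofReal_ofNat, ← ENNReal.ofReal_mul (by norm_num)]
  apply ENNReal.ofReal_le_ofReal
  norm_num
  linarith

lemma setLIntegral_rieszKernel_pow_le {r : ℝ} (hr : 0 < r) :
    ∫⁻ z : ℝ, ({z | |z| ≤ r}ᶜ.indicator rieszKernel z) ^ (4 : ℝ) ≤ ENNReal.ofReal (2 / r) := by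
  have h0 : ∀ z : ℝ, ({z | |z| ≤ r}ᶜ.indicator rieszKernel z) ^ (4 : ℝ) =
      (Ioi r).indicator (fun y => ENNReal.ofReal y ^ (-2 : ℝ)) |z| := fun z => by
    by_cases h : |z| ≤ r
    · simp [indicator, h]
    · simp only [indicator, rieszKernel, mem_compl_iff, mem_ofPred_eq, h, not_false_eq_true,
        mem_Ioi, not_le.1 h, if_true, ← ENNReal.rpow_mul]
      norm_num
  simp_rw [h0]
  rw [lintegral_comp_abs_eq,
    setLIntegral_indicator measurableSet_Ioi, Ioi_inter_Ioi, max_eq_left hr.le]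
  have h1 : ∫⁻ z in Ioi r, ENNReal.ofReal z ^ (-2 : ℝ)
      = ∫⁻ z in Ioi r, ENNReal.ofReal (z ^ (-2 : ℝ)) :=
    setLIntegral_congr_fun measurableSet_Ioi fun z hz =>
      ENNReal.ofReal_rpow_of_pos (hr.trans hz)
  rw [h1, ← ofReal_integral_eq_lintegral_ofReal
      (integrableOn_Ioi_rpow_of_lt (by norm_num) hr)
      ((ae_restrict_iff' measurableSet_Ioi).2
        (ae_of_all _ fun z hz => Real.rpow_nonneg (hr.trans hz).le _)),
    integral_Ioi_rpow_of_lt (by norm_num) hr,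
    ← ENNReal.ofReal_ofNat, ← ENNReal.ofReal_mul (by norm_num)]
  apply ENNReal.ofReal_le_ofReal
  norm_num
  rw [Real.rpow_neg_one, div_eq_mul_inv]

lemma lintegral_le_mul_rieszKernel_le {F : ℝ → ℝ≥0∞} (hF : Measurable F) {m n : ℝ} (hm : 0 < m)
    (hn : 0 < n) (hN : (∫⁻ y, F y ^ (4 / 3 : ℝ)) ^ (3 / 4 : ℝ) = ENNReal.ofReal n) (x : ℝ) :
    ∫⁻ y, {y | F y ≤ ENNReal.ofReal m}.indicator F y * rieszKernel (x - y)
      ≤ ENNReal.ofReal (6 * (m ^ (1 / 3 : ℝ) * n ^ (2 / 3 : ℝ))) := by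
  set r : ℝ := (n / m) ^ (4 / 3 : ℝ) with hr
  have hr0 : 0 < r := by positivity
  set K1 : ℝ → ℝ≥0∞ := {z | |z| ≤ r}.indicator rieszKernel with hK1
  set K2 : ℝ → ℝ≥0∞ := {z | |z| ≤ r}ᶜ.indicator rieszKernel with hK2
  have hms : MeasurableSet {z : ℝ | |z| ≤ r} := measurableSet_le (by fun_prop) (by fun_prop)
  have hK1m : Measurable K1 := measurable_rieszKernel.indicator hms
  have hK2m : Measurable K2 := measurable_rieszKernel.indicator hms.compl
  have h1 : ∫⁻ y, ENNReal.ofReal m * K1 (x - y) ≤ ENNReal.ofReal (m * (4 * r ^ (1 / 2 : ℝ))) := by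
    rw [lintegral_const_mul _ (by fun_prop), lintegral_sub_left_eq_self, ENNReal.ofReal_mul hm.le]
    gcongr
    exact setLIntegral_rieszKernel_le hr0
  have h2 : ∫⁻ y, F y * K2 (x - y) ≤ ENNReal.ofReal (n * (2 / r) ^ (1 / 4 : ℝ)) := by
    have := ENNReal.lintegral_mul_le_Lp_mul_Lq volume (p := 4 / 3) (q := 4)
      (Real.holderConjugate_iff.2 ⟨by norm_num, by norm_num⟩) hF.aemeasurable
      (hK2m.comp (measurable_const.sub measurable_id) : Measurable fun y => K2 (x - y)).aemeasurable
    refine this.trans ?_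
    simp only [Function.comp_apply]
    rw [lintegral_sub_left_eq_self (fun z => K2 z ^ (4 : ℝ)),
      show (1 / (4 / 3) : ℝ) = 3 / 4 by norm_num, hN,
      ENNReal.ofReal_mul hn.le, ← ENNReal.ofReal_rpow_of_pos (by positivity)]
    gcongr
    exact setLIntegral_rieszKernel_pow_le hr0
  calc _ ≤ ∫⁻ y, (ENNReal.ofReal m * K1 (x - y) + F y * K2 (x - y)) := by
        refine lintegral_mono fun y => ?_
        by_cases hy : F y ≤ ENNReal.ofReal m <;> by_cases hz : |x - y| ≤ r <;>
          simp [hK1, hK2, indicator, hy, hz]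
        gcongr
    _ = (∫⁻ y, ENNReal.ofReal m * K1 (x - y)) + ∫⁻ y, F y * K2 (x - y) :=
        lintegral_add_left (by fun_prop) _
    _ ≤ _ := by
      refine (add_le_add h1 h2).trans ?_
      rw [← ENNReal.ofReal_add (by positivity) (by positivity)]
      apply ENNReal.ofReal_le_ofReal
      have e1 : m * (4 * r ^ (1 / 2 : ℝ)) = 4 * (m ^ (1 / 3 : ℝ) * n ^ (2 / 3 : ℝ)) := by
        have : m = m ^ (1 / 3 : ℝ) * m ^ (2 / 3 : ℝ) := by
          rw [← Real.rpow_add hm]; norm_num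
        rw [hr, ← Real.rpow_mul (by positivity), Real.div_rpow hn.le hm.le]
        norm_num
        have h3 : m ^ (2 / 3 : ℝ) ≠ 0 := by positivity
        field_simp
        linarith
      have e2 : n * (2 / r) ^ (1 / 4 : ℝ)
          = 2 ^ (1 / 4 : ℝ) * (m ^ (1 / 3 : ℝ) * n ^ (2 / 3 : ℝ)) := by
        have : n = n ^ (2 / 3 : ℝ) * n ^ (1 / 3 : ℝ) := by
          rw [← Real.rpow_add hn]; norm_num
        rw [Real.div_rpow (by norm_num) hr0.le, hr, ← Real.rpow_mul (by positivity),
          Real.div_rpow hn.le hm.le]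
        norm_num
        have h3 : m ^ (1 / 3 : ℝ) ≠ 0 := by positivity
        have h4 : n ^ (1 / 3 : ℝ) ≠ 0 := by positivity
        field_simp
        linarith
      have e3 : (2 : ℝ) ^ (1 / 4 : ℝ) ≤ 2 := by
        conv_rhs => rw [← Real.rpow_one 2]
        exact Real.rpow_le_rpow_of_exponent_le (by norm_num) (by norm_num)
      have e4 : 0 ≤ m ^ (1 / 3 : ℝ) * n ^ (2 / 3 : ℝ) := by positivity
      rw [e1, e2]
      nlinarith

/-- Hardy–Littlewood–Sobolev inequality in the diagonal case `L^{4/3} × L^{4/3}` on the line. -/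
lemma lintegral_lintegral_mul_rieszKernel_le {F : ℝ → ℝ≥0∞} (hF : Measurable F)
    (hfin : ∀ x, F x ≠ ∞) :
    ∫⁻ x, ∫⁻ y, F x * F y * rieszKernel (x - y)
      ≤ 12 * (∫⁻ x, F x ^ (4 / 3 : ℝ)) ^ (3 / 2 : ℝ) := by
  set J := ∫⁻ x, F x ^ (4 / 3 : ℝ) with hJ
  rcases eq_or_ne J 0 with h0 | h0
  · have hz : F =ᵐ[volume] 0 := by
      have := (lintegral_eq_zero_iff (hF.pow_const _)).1 (hJ.symm.trans h0)
      filter_upwards [this] with x hx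
      simpa using (ENNReal.rpow_eq_zero_iff_of_pos (by norm_num)).1 hx
    have : ∫⁻ x, ∫⁻ y, F x * F y * rieszKernel (x - y) = ∫⁻ _ : ℝ, 0 := by
      refine lintegral_congr_ae ?_
      filter_upwards [hz] with x hx
      simp [hx]
    simp [this]
  rcases eq_or_ne J ∞ with hi | hi
  · rw [hi, ENNReal.top_rpow_of_pos (by norm_num)]
    simp
  obtain ⟨n, hn, hN⟩ : ∃ n : ℝ, 0 < n ∧ J ^ (3 / 4 : ℝ) = ENNReal.ofReal n := by
    have h1 : J ^ (3 / 4 : ℝ) ≠ ∞ := ENNReal.rpow_ne_top_of_nonneg (by norm_num) hi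
    have h2 : J ^ (3 / 4 : ℝ) ≠ 0 := by
      rw [Ne, ENNReal.rpow_eq_zero_iff_of_pos (by norm_num)]; exact h0
    exact ⟨_, ENNReal.toReal_pos h2 h1, (ENNReal.ofReal_toReal h1).symm⟩
  set A : ℝ → ℝ → ℝ≥0∞ := fun x y =>
    F x * ({y | F y ≤ F x}.indicator F y * rieszKernel (x - y)) with hA
  have hAm : Measurable (Function.uncurry A) := by
    have h1 : Measurable fun p : ℝ × ℝ => {p : ℝ × ℝ | F p.2 ≤ F p.1}.indicator (fun p => F p.2) p :=
      Measurable.indicator (by fun_prop) (measurableSet_le (by fun_prop) (by fun_prop))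
    have h2 : Measurable fun p : ℝ × ℝ => rieszKernel (p.1 - p.2) := by fun_prop
    exact (hF.comp measurable_fst).mul (h1.mul h2)
  have hpt : ∀ x y, F x * F y * rieszKernel (x - y) ≤ A x y + A y x := by
    intro x y
    have hs : rieszKernel (y - x) = rieszKernel (x - y) := by rw [← neg_sub, rieszKernel_neg]
    rcases le_total (F y) (F x) with h | h
    · refine le_trans (le_of_eq ?_) le_self_add
      simp [hA, indicator, h, mul_assoc]
    · refine le_trans (le_of_eq ?_) le_add_self
      simp only [hA, indicator, mem_ofPred_eq, h, if_true, hs]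
      ring
  have hAx : ∀ x, ∫⁻ y, A x y ≤ 6 * ENNReal.ofReal n ^ (2 / 3 : ℝ) * F x ^ (4 / 3 : ℝ) := by
    intro x
    rcases eq_or_ne (F x) 0 with hx | hx
    · simp [hA, hx]
    have hm : 0 < (F x).toReal := ENNReal.toReal_pos hx (hfin x)
    have hFx : F x = ENNReal.ofReal (F x).toReal := (ENNReal.ofReal_toReal (hfin x)).symm
    have h := lintegral_le_mul_rieszKernel_le hF hm hn hN x
    rw [← hFx] at h
    have h1 : Measurable fun y => {y | F y ≤ F x}.indicator F y * rieszKernel (x - y) :=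
      (hF.indicator (measurableSet_le hF measurable_const)).mul (by fun_prop)
    rw [lintegral_const_mul _ h1]
    refine (mul_le_mul_right h (F x)).trans (le_of_eq ?_)
    rw [ENNReal.ofReal_mul (by norm_num), ENNReal.ofReal_mul (by positivity),
      ← ENNReal.ofReal_rpow_of_pos hm, ← ENNReal.ofReal_rpow_of_pos hn, ← hFx]
    have : F x ^ (4 / 3 : ℝ) = F x * F x ^ (1 / 3 : ℝ) := by
      conv_rhs => rw [← ENNReal.rpow_one (F x), ← ENNReal.rpow_mul, one_mul]
      rw [← ENNReal.rpow_add _ _ hx (hfin x)]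
      norm_num
    rw [this, ENNReal.ofReal_ofNat]
    ring
  have hAA : ∫⁻ x, ∫⁻ y, A x y ≤ 6 * J ^ (3 / 2 : ℝ) := by
    refine (lintegral_mono hAx).trans (le_of_eq ?_)
    rw [lintegral_const_mul _ (by fun_prop), ← hJ, ← hN, ← ENNReal.rpow_mul, mul_assoc]
    congr 1
    conv_lhs => rw [← ENNReal.rpow_one J, ← ENNReal.rpow_mul, one_mul]
    rw [← ENNReal.rpow_add _ _ h0 hi]
    norm_num
  calc _ ≤ ∫⁻ x, ∫⁻ y, (A x y + A y x) := lintegral_mono fun x => lintegral_mono fun y => hpt x y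
    _ = (∫⁻ x, ∫⁻ y, A x y) + ∫⁻ x, ∫⁻ y, A y x := by
      have h := lintegral_add_left (μ := volume) (Measurable.lintegral_prod_right' (ν := volume) hAm) fun x => ∫⁻ y, A y x
      refine Eq.trans (lintegral_congr fun x => ?_) h
      exact lintegral_add_left (hAm.comp measurable_prodMk_left) _
    _ = (∫⁻ x, ∫⁻ y, A x y) + ∫⁻ x, ∫⁻ y, A x y := by
      rw [lintegral_lintegral_swap (f := fun x y => A y x) (hAm.comp measurable_swap).aemeasurable]
    _ ≤ 6 * J ^ (3 / 2 : ℝ) + 6 * J ^ (3 / 2 : ℝ) := add_le_add hAA hAA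
    _ = _ := by rw [← add_mul]; norm_num

lemma lintegral_rpow_mul_exp {b : ℝ} (hb : 0 < b) :
    ∫⁻ l in Ioi (0 : ℝ), ENNReal.ofReal (l ^ (-(3 / 4) : ℝ) * rexp (-(b * l)))
      = ENNReal.ofReal ((1 / b) ^ (1 / 4 : ℝ) * Gamma (1 / 4)) := by
  have h := Real.integral_rpow_mul_exp_neg_mul_Ioi (a := 1 / 4) (by norm_num) hb
  rw [show (1 / 4 - 1 : ℝ) = -(3 / 4) by norm_num] at h
  rw [← h]
  refine (ofReal_integral_eq_lintegral_ofReal ?_ ?_).symm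
  · by_contra hni
    rw [integral_undef hni] at h
    have : 0 < (1 / b) ^ (1 / 4 : ℝ) * Gamma (1 / 4) :=
      mul_pos (by positivity) (Gamma_pos_of_pos (by norm_num))
    linarith
  · exact (ae_restrict_iff' measurableSet_Ioi).2
      (ae_of_all _ fun z hz => mul_nonneg (Real.rpow_nonneg (le_of_lt hz) _) (exp_nonneg _))

lemma lintegral_rpow_mul_exp_inv {b : ℝ} (hb : 0 < b) :
    ∫⁻ l in Ioi (0 : ℝ), ENNReal.ofReal (l ^ (-(5 / 4) : ℝ) * rexp (-(b * l⁻¹)))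
      = ENNReal.ofReal ((1 / b) ^ (1 / 4 : ℝ) * Gamma (1 / 4)) := by
  have himg : (fun x : ℝ => x⁻¹) '' Ioi 0 = Ioi 0 := by
    ext x
    constructor
    · rintro ⟨y, hy, rfl⟩
      exact inv_pos.2 (mem_Ioi.1 hy)
    · intro hx
      exact ⟨x⁻¹, inv_pos.2 (mem_Ioi.1 hx), inv_inv x⟩
  rw [← lintegral_rpow_mul_exp hb]
  conv_lhs => rw [← himg]
  rw [lintegral_image_eq_lintegral_abs_deriv_mul measurableSet_Ioi
    (fun x hx => (hasDerivAt_inv (ne_of_gt hx)).hasDerivWithinAt) inv_injective.injOn]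
  refine setLIntegral_congr_fun measurableSet_Ioi fun x hx => ?_
  have hx' : 0 < x := hx
  rw [← ENNReal.ofReal_mul (abs_nonneg _), inv_inv, abs_neg, abs_of_nonneg (by positivity),
    ← mul_assoc]
  congr 2
  rw [Real.inv_rpow hx'.le, ← Real.rpow_neg hx'.le, ← Real.rpow_natCast, ← Real.rpow_neg hx'.le,
    ← Real.rpow_add hx']
  norm_num

lemma rieszKernel_mul_gamma {x : ℝ} (hx : x ≠ 0) :
    rieszKernel x * ENNReal.ofReal (Gamma (1 / 4))
      = ∫⁻ l in Ioi (0 : ℝ), ENNReal.ofReal (l ^ (-(3 / 4) : ℝ) * rexp (-l * x ^ 2)) := by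
  have h := lintegral_rpow_mul_exp (b := x ^ 2) (by positivity)
  have h0 : 0 < |x| := abs_pos.2 hx
  have h1 : (1 / x ^ 2) ^ (1 / 4 : ℝ) = |x| ^ (-(1 / 2) : ℝ) := by
    rw [← sq_abs, ← Real.rpow_natCast, one_div, ← Real.rpow_neg h0.le, ← Real.rpow_mul h0.le]
    norm_num
  rw [h1, ENNReal.ofReal_mul (by positivity), ← ENNReal.ofReal_rpow_of_pos h0] at h
  rw [rieszKernel, ← h]
  refine lintegral_congr fun l => ?_
  ring_nf

lemma gaussKernel_le {l : ℝ} (hl : 0 < l) (a b : ℝ) :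
    gaussKernel l a b ≤ √π * (|b| ^ (-(1 / 2) : ℝ) * rexp (-(a ^ 2 / (8 * b ^ 2) * l))
      + l ^ (-(1 / 2) : ℝ) * rexp (-(a ^ 2 / 8 * l⁻¹))) := by
  have hq : 0 < l ^ 2 + b ^ 2 := by positivity
  have hsq : ∀ x : ℝ, 0 < x → (x ^ 2) ^ (-(1 / 4) : ℝ) = x ^ (-(1 / 2) : ℝ) := fun x hx => by
    rw [← Real.rpow_natCast, ← Real.rpow_mul hx.le]
    norm_num
  rw [gaussKernel, mul_assoc]
  refine mul_le_mul_of_nonneg_left ?_ (sqrt_nonneg _)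
  rcases le_or_gt |b| l with h | h
  · refine le_trans ?_ (le_add_of_nonneg_left (by positivity))
    have hb2 : b ^ 2 ≤ l ^ 2 := sq_le_sq' (by linarith [neg_abs_le b]) (by linarith [le_abs_self b])
    refine mul_le_mul ?_ ?_ (exp_nonneg _) (by positivity)
    · rw [← hsq l hl]
      exact Real.rpow_le_rpow_of_nonpos (by positivity) (by nlinarith) (by norm_num)
    · apply Real.exp_le_exp.2
      rw [neg_div, neg_le_neg_iff, ← div_eq_mul_inv, div_div, div_le_div_iff₀ (by positivity) (by positivity)]
      nlinarith [mul_nonneg (sq_nonneg a) (sub_nonneg.2 hb2)]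
  · refine le_trans ?_ (le_add_of_nonneg_right (by positivity))
    have hb0 : 0 < |b| := hl.trans h
    have hb2 : l ^ 2 ≤ b ^ 2 := by rw [← sq_abs b]; exact pow_le_pow_left₀ hl.le h.le 2
    have hb2p : 0 < b ^ 2 := by rw [← sq_abs b]; positivity
    refine mul_le_mul ?_ ?_ (exp_nonneg _) (by positivity)
    · rw [← hsq _ hb0, sq_abs]
      exact Real.rpow_le_rpow_of_nonpos (by positivity) (by nlinarith) (by norm_num)
    · apply Real.exp_le_exp.2
      rw [neg_div, neg_le_neg_iff, div_mul_eq_mul_div, div_le_div_iff₀ (by positivity) (by positivity)]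
      nlinarith [mul_nonneg (mul_nonneg (sq_nonneg a) hl.le) (sub_nonneg.2 hb2)]

lemma lintegral_gaussKernel_le (a b : ℝ) :
    ∫⁻ l in Ioi (0 : ℝ), ENNReal.ofReal (l ^ (-(3 / 4) : ℝ)) * ENNReal.ofReal (gaussKernel l a b)
      ≤ ENNReal.ofReal (2 * √π * 8 ^ (1 / 4 : ℝ) * Gamma (1 / 4)) * rieszKernel a := by
  have hΓ : 0 < Gamma (1 / 4) := Gamma_pos_of_pos (by norm_num)
  rcases eq_or_ne a 0 with rfl | ha
  · have : rieszKernel 0 = ∞ := by simp [rieszKernel]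
    rw [this, ENNReal.mul_top]
    · exact le_top
    · simp only [ne_eq, ENNReal.ofReal_eq_zero, not_le]
      positivity
  have ha0 : 0 < |a| := abs_pos.2 ha
  have ha8 : (1 / (a ^ 2 / 8)) ^ (1 / 4 : ℝ) = 8 ^ (1 / 4 : ℝ) * |a| ^ (-(1 / 2) : ℝ) := by
    rw [one_div_div, Real.div_rpow (by norm_num) (by positivity), ← sq_abs, ← Real.rpow_natCast,
      ← Real.rpow_mul ha0.le, div_eq_mul_inv, ← Real.rpow_neg ha0.le]
    norm_num
  set c := √π * (8 ^ (1 / 4 : ℝ) * |a| ^ (-(1 / 2) : ℝ) * Gamma (1 / 4)) with hc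
  have hc0 : 0 ≤ c := by positivity
  have h1 : ∫⁻ l in Ioi (0 : ℝ), ENNReal.ofReal (√π * |b| ^ (-(1 / 2) : ℝ)) *
      ENNReal.ofReal (l ^ (-(3 / 4) : ℝ) * rexp (-(a ^ 2 / (8 * b ^ 2) * l)))
        ≤ ENNReal.ofReal c := by
    rcases eq_or_ne b 0 with rfl | hb
    · simp
    have hb0 : 0 < |b| := abs_pos.2 hb
    rw [lintegral_const_mul _ (by fun_prop), lintegral_rpow_mul_exp (by positivity),
      ← ENNReal.ofReal_mul (by positivity)]
    apply ENNReal.ofReal_le_ofReal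
    apply le_of_eq
    have : (1 / (a ^ 2 / (8 * b ^ 2))) ^ (1 / 4 : ℝ)
        = |b| ^ (1 / 2 : ℝ) * (8 ^ (1 / 4 : ℝ) * |a| ^ (-(1 / 2) : ℝ)) := by
      rw [← ha8, show (1 / (a ^ 2 / (8 * b ^ 2))) = |b| ^ 2 * (1 / (a ^ 2 / 8)) by
        rw [sq_abs]; field_simp, Real.mul_rpow (by positivity) (by positivity),
        ← Real.rpow_natCast, ← Real.rpow_mul hb0.le]
      norm_num
    rw [this, hc, Real.rpow_neg hb0.le]
    have : |b| ^ (1 / 2 : ℝ) ≠ 0 := by positivity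
    field_simp
  have h2 : ∫⁻ l in Ioi (0 : ℝ), ENNReal.ofReal √π *
      ENNReal.ofReal (l ^ (-(5 / 4) : ℝ) * rexp (-(a ^ 2 / 8 * l⁻¹))) ≤ ENNReal.ofReal c := by
    rw [lintegral_const_mul _ (by fun_prop), lintegral_rpow_mul_exp_inv (by positivity), ha8,
      ← ENNReal.ofReal_mul (by positivity)]
  calc _ ≤ ∫⁻ l in Ioi (0 : ℝ), (ENNReal.ofReal (√π * |b| ^ (-(1 / 2) : ℝ)) *
      ENNReal.ofReal (l ^ (-(3 / 4) : ℝ) * rexp (-(a ^ 2 / (8 * b ^ 2) * l))) + ENNReal.ofReal √π *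
      ENNReal.ofReal (l ^ (-(5 / 4) : ℝ) * rexp (-(a ^ 2 / 8 * l⁻¹)))) := by
        refine setLIntegral_mono' measurableSet_Ioi fun l hl => ?_
        have hl0 : 0 < l := hl
        rw [← ENNReal.ofReal_mul (by positivity), ← ENNReal.ofReal_mul (by positivity),
          ← ENNReal.ofReal_mul (by positivity), ← ENNReal.ofReal_add (by positivity) (by positivity)]
        apply ENNReal.ofReal_le_ofReal
        refine (mul_le_mul_of_nonneg_left (gaussKernel_le hl0 a b) (by positivity)).trans
          (le_of_eq ?_)
        have : l ^ (-(5 / 4) : ℝ) = l ^ (-(3 / 4) : ℝ) * l ^ (-(1 / 2) : ℝ) := by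
          rw [← Real.rpow_add hl0]; norm_num
        rw [this]
        ring
    _ ≤ ENNReal.ofReal c + ENNReal.ofReal c := by
        rw [lintegral_add_left (by fun_prop)]
        exact add_le_add h1 h2
    _ = _ := by
        rw [← ENNReal.ofReal_add hc0 hc0, rieszKernel, ENNReal.ofReal_rpow_of_pos ha0,
          ← ENNReal.ofReal_mul (by positivity)]
        congr 1
        rw [hc]
        ring

/-- The `TT*` estimate behind the Kenig–Ruiz maximal inequality: for a measurable choice of times
`β`, the weighted `L²` norm of the oscillatory integral is controlled by a Riesz potential. -/
lemma lintegral_rieszKernel_mul_enorm_sq_le {G : ℝ → ℂ} (hG : Integrable G)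
    {α β : ℝ → ℝ} (hα : Measurable α) (hβ : Measurable β) :
    ∫⁻ ξ : ℝ, rieszKernel ξ *
        ‖∫ x, Complex.exp (Complex.I * ((ξ * α x + ξ ^ 2 * β x : ℝ) : ℂ)) * G x‖ₑ ^ 2
      ≤ ENNReal.ofReal (2 * √π * 8 ^ (1 / 4 : ℝ)) *
        ∫⁻ x, ∫⁻ y, ‖G x‖ₑ * ‖G y‖ₑ * rieszKernel (α x - α y) := by
  have hΓ : 0 < Gamma (1 / 4) := Gamma_pos_of_pos (by norm_num)
  have hΓ0 : ENNReal.ofReal (Gamma (1 / 4)) ≠ 0 := by simpa using hΓ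
  wlog hGm : StronglyMeasurable G generalizing G
  · have h := this (G := hG.aestronglyMeasurable.mk G)
      (hG.congr hG.aestronglyMeasurable.ae_eq_mk) hG.aestronglyMeasurable.stronglyMeasurable_mk
    have hae := hG.aestronglyMeasurable.ae_eq_mk
    refine (le_of_eq ?_).trans (h.trans (le_of_eq ?_))
    · refine lintegral_congr fun ξ => ?_
      congr 3
      refine integral_congr_ae ?_
      filter_upwards [hae] with x hx
      rw [hx]
    · congr 1
      refine lintegral_congr_ae ?_
      filter_upwards [hae] with x hx
      refine lintegral_congr_ae ?_
      filter_upwards [hae] with y hy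
      rw [hx, hy]
  set S : ℝ → ℂ := fun ξ =>
    ∫ x, Complex.exp (Complex.I * ((ξ * α x + ξ ^ 2 * β x : ℝ) : ℂ)) * G x with hS
  have hSm : Measurable S := by
    refine StronglyMeasurable.measurable ?_
    refine StronglyMeasurable.integral_prod_right' (f := fun p : ℝ × ℝ =>
      Complex.exp (Complex.I * ((p.1 * α p.2 + p.1 ^ 2 * β p.2 : ℝ) : ℂ)) * G p.2) ?_
    refine (Measurable.stronglyMeasurable ?_).mul (hGm.comp_measurable measurable_snd)
    fun_prop
  have hgk : Measurable fun p : ℝ × ℝ × ℝ => gaussKernel p.1 p.2.1 p.2.2 := by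
    unfold gaussKernel
    fun_prop
  have hGe : Measurable fun x => ‖G x‖ₑ := hGm.enorm
  rw [← ENNReal.mul_le_mul_iff_right hΓ0 ENNReal.ofReal_ne_top]
  calc ENNReal.ofReal (Gamma (1 / 4)) * ∫⁻ ξ : ℝ, rieszKernel ξ * ‖S ξ‖ₑ ^ 2
      = ∫⁻ ξ : ℝ, ∫⁻ l in Ioi (0 : ℝ),
          ENNReal.ofReal (l ^ (-(3 / 4) : ℝ) * rexp (-l * ξ ^ 2)) * ‖S ξ‖ₑ ^ 2 := by
        rw [← lintegral_const_mul _ (by fun_prop)]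
        refine lintegral_congr_ae ?_
        filter_upwards [compl_mem_ae_iff.2 (measure_singleton (0 : ℝ))] with ξ hξ
        rw [lintegral_mul_const _ (by fun_prop), ← rieszKernel_mul_gamma hξ]
        ring
    _ = ∫⁻ l in Ioi (0 : ℝ), ∫⁻ ξ : ℝ,
          ENNReal.ofReal (l ^ (-(3 / 4) : ℝ) * rexp (-l * ξ ^ 2)) * ‖S ξ‖ₑ ^ 2 := by
        refine lintegral_lintegral_swap (Measurable.aemeasurable ?_)
        simp only [Function.uncurry_def]
        fun_prop
    _ ≤ ∫⁻ l in Ioi (0 : ℝ), ∫⁻ z : ℝ × ℝ, ‖G z.1‖ₑ * ‖G z.2‖ₑ *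
          (ENNReal.ofReal (l ^ (-(3 / 4) : ℝ)) *
            ENNReal.ofReal (gaussKernel l (α z.1 - α z.2) (β z.1 - β z.2))) := by
        refine setLIntegral_mono' measurableSet_Ioi fun l hl => ?_
        calc _ = ENNReal.ofReal (l ^ (-(3 / 4) : ℝ)) *
              ∫⁻ ξ : ℝ, ENNReal.ofReal (rexp (-l * ξ ^ 2)) * ‖S ξ‖ₑ ^ 2 := by
              rw [← lintegral_const_mul _ (by fun_prop)]
              refine lintegral_congr fun ξ => ?_
              rw [ENNReal.ofReal_mul (Real.rpow_nonneg (le_of_lt hl) _), mul_assoc]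
          _ ≤ ENNReal.ofReal (l ^ (-(3 / 4) : ℝ)) * ∫⁻ x, ∫⁻ y, ‖G x‖ₑ * ‖G y‖ₑ *
              ENNReal.ofReal (gaussKernel l (α x - α y) (β x - β y)) := by
              exact mul_le_mul_right (lintegral_gaussian_mul_enorm_sq_le hG hα hβ hl) _
          _ = _ := by
              have hm : Measurable fun z : ℝ × ℝ => ‖G z.1‖ₑ * ‖G z.2‖ₑ *
                  ENNReal.ofReal (gaussKernel l (α z.1 - α z.2) (β z.1 - β z.2)) := by
                refine Measurable.mul (by fun_prop) (ENNReal.measurable_ofReal.comp ?_)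
                exact hgk.comp (f := fun z : ℝ × ℝ => (l, α z.1 - α z.2, β z.1 - β z.2))
                  (by fun_prop)
              rw [Measure.volume_eq_prod, ← lintegral_prod _ hm.aemeasurable,
                ← lintegral_const_mul _ hm]
              refine lintegral_congr fun z => ?_
              ring
    _ = ∫⁻ z : ℝ × ℝ, ∫⁻ l in Ioi (0 : ℝ), ‖G z.1‖ₑ * ‖G z.2‖ₑ *
          (ENNReal.ofReal (l ^ (-(3 / 4) : ℝ)) *
            ENNReal.ofReal (gaussKernel l (α z.1 - α z.2) (β z.1 - β z.2))) := by
        refine lintegral_lintegral_swap (Measurable.aemeasurable ?_)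
        simp only [Function.uncurry_def]
        refine Measurable.mul (by fun_prop) (Measurable.mul (by fun_prop)
          (ENNReal.measurable_ofReal.comp ?_))
        exact hgk.comp (f := fun p : ℝ × ℝ × ℝ => (p.1, α p.2.1 - α p.2.2, β p.2.1 - β p.2.2))
          (by fun_prop)
    _ ≤ ∫⁻ z : ℝ × ℝ, ENNReal.ofReal (2 * √π * 8 ^ (1 / 4 : ℝ) * Gamma (1 / 4)) *
          (‖G z.1‖ₑ * ‖G z.2‖ₑ * rieszKernel (α z.1 - α z.2)) := by
        refine lintegral_mono fun z => ?_
        have hm : Measurable fun l : ℝ => ENNReal.ofReal (l ^ (-(3 / 4) : ℝ)) *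
            ENNReal.ofReal (gaussKernel l (α z.1 - α z.2) (β z.1 - β z.2)) :=
          Measurable.mul (by fun_prop) (ENNReal.measurable_ofReal.comp
            (hgk.comp (f := fun l : ℝ => (l, α z.1 - α z.2, β z.1 - β z.2)) (by fun_prop)))
        simp only
        rw [lintegral_const_mul _ hm, mul_left_comm]
        gcongr
        exact lintegral_gaussKernel_le _ _
    _ = _ := by
        have hm : Measurable fun z : ℝ × ℝ => ‖G z.1‖ₑ * ‖G z.2‖ₑ * rieszKernel (α z.1 - α z.2) := by
          fun_prop
        rw [lintegral_const_mul _ hm, Measure.volume_eq_prod, lintegral_prod _ hm.aemeasurable,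
          ← mul_assoc, ← ENNReal.ofReal_mul hΓ.le]
        congr 2
        ring

/-- The oscillating factor `e^{2πixξ + itξ|ξ|}`. -/
def osc (x t ξ : ℝ) : ℂ := Complex.exp (Complex.I * ((2 * π * x * ξ + t * (ξ * |ξ|) : ℝ) : ℂ))

lemma norm_osc (x t ξ : ℝ) : ‖osc x t ξ‖ = 1 := Complex.norm_exp_I_mul_ofReal _

lemma continuous_osc : Continuous fun p : ℝ × ℝ × ℝ => osc p.1 p.2.1 p.2.2 := by
  unfold osc
  fun_prop

@[fun_prop]
lemma Measurable.osc {Y : Type*} [MeasurableSpace Y] {f g h : Y → ℝ} (hf : Measurable f)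
    (hg : Measurable g) (hh : Measurable h) : Measurable fun y => osc (f y) (g y) (h y) :=
  continuous_osc.measurable.comp (hf.prodMk (hg.prodMk hh))

/-- The superposition `∫ e^{2πixξ + itξ|ξ|} a(ξ) dξ` of free waves. -/
def wave (a : ℝ → ℂ) (x t : ℝ) : ℂ := ∫ ξ, osc x t ξ * a ξ

lemma integrable_osc_mul {a : ℝ → ℂ} (ha : Integrable a) (x t : ℝ) :
    Integrable fun ξ => osc x t ξ * a ξ :=
  ha.bdd_mul (c := 1) (Measurable.aestronglyMeasurable (by fun_prop))
    (ae_of_all _ fun ξ => (norm_osc x t ξ).le)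

lemma norm_wave_le (a : ℝ → ℂ) (x t : ℝ) : ‖wave a x t‖ ≤ ∫ ξ, ‖a ξ‖ := by
  refine (norm_integral_le_integral_norm _).trans (le_of_eq ?_)
  simp [norm_osc]

lemma continuous_wave {a : ℝ → ℂ} (ha : Integrable a) :
    Continuous fun p : ℝ × ℝ => wave a p.1 p.2 := by
  refine continuous_of_dominated (bound := fun ξ => ‖a ξ‖)
    (fun p => (integrable_osc_mul ha p.1 p.2).aestronglyMeasurable)
    (fun p => ae_of_all _ fun ξ => by simp [norm_osc]) ha.norm (ae_of_all _ fun ξ => ?_)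
  exact (continuous_osc.comp (by fun_prop : Continuous fun p : ℝ × ℝ => (p.1, p.2, ξ))).mul
    continuous_const

lemma measurable_wave {a : ℝ → ℂ} (ha : Integrable a) {τ : ℝ → ℝ} (hτ : Measurable τ) :
    Measurable fun x => wave a x (τ x) := by
  have h : Measurable fun x : ℝ => (x, τ x) := measurable_id.prodMk hτ
  have h2 : Measurable fun p : ℝ × ℝ => wave a p.1 p.2 := (continuous_wave ha).measurable
  have h3 := h2.comp h
  exact h3

lemma rieszKernel_mul_le {c : ℝ} (hc : 1 ≤ c) (z : ℝ) : rieszKernel (c * z) ≤ rieszKernel z := by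
  unfold rieszKernel
  rw [ENNReal.rpow_neg, ENNReal.rpow_neg, ENNReal.inv_le_inv, abs_mul, abs_of_pos (by linarith : 0 < c)]
  exact ENNReal.rpow_le_rpow
    (ENNReal.ofReal_le_ofReal (le_mul_of_one_le_left (abs_nonneg z) hc)) (by norm_num)

/-- The constant in the dual form of the maximal inequality. -/
def dualConst : ℝ≥0∞ := 2 * (ENNReal.ofReal (2 * √π * 8 ^ (1 / 4 : ℝ)) * 12)

lemma lintegral_rieszKernel_mul_dual_le {G : ℝ → ℂ} (hG : Integrable G) (hGm : Measurable G)
    {τ : ℝ → ℝ} (hτ : Measurable τ) :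
    ∫⁻ ξ : ℝ, rieszKernel ξ * ‖∫ x, osc x (τ x) ξ * G x‖ₑ ^ 2
      ≤ dualConst * (∫⁻ x, ‖G x‖ₑ ^ (4 / 3 : ℝ)) ^ (3 / 2 : ℝ) := by
  have key : ∀ β : ℝ → ℝ, Measurable β → ∫⁻ ξ : ℝ, rieszKernel ξ *
      ‖∫ x, Complex.exp (Complex.I * ((ξ * (2 * π * x) + ξ ^ 2 * β x : ℝ) : ℂ)) * G x‖ₑ ^ 2
      ≤ ENNReal.ofReal (2 * √π * 8 ^ (1 / 4 : ℝ)) * 12 *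
        (∫⁻ x, ‖G x‖ₑ ^ (4 / 3 : ℝ)) ^ (3 / 2 : ℝ) := by
    intro β hβ
    refine (lintegral_rieszKernel_mul_enorm_sq_le hG (α := fun x => 2 * π * x) (by fun_prop)
      hβ).trans ?_
    rw [mul_assoc (ENNReal.ofReal _) 12]
    refine mul_le_mul_right (le_trans ?_ (lintegral_lintegral_mul_rieszKernel_le hGm.enorm
      fun x => enorm_ne_top)) _
    refine lintegral_mono fun x => lintegral_mono fun y => mul_le_mul_right ?_ _
    rw [← mul_sub]
    exact rieszKernel_mul_le (by nlinarith [pi_gt_three]) _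
  rw [← lintegral_add_compl _ (measurableSet_Ioi (a := (0 : ℝ))), dualConst, mul_assoc, two_mul]
  refine add_le_add (le_trans ?_ (key τ hτ)) (le_trans ?_ (key (fun x => -τ x) hτ.neg))
  · refine le_trans (le_of_eq ?_) (setLIntegral_le_lintegral (Ioi 0) _)
    refine setLIntegral_congr_fun measurableSet_Ioi fun ξ hξ => ?_
    simp only [osc, abs_of_pos (mem_Ioi.1 hξ)]
    congr 3
    refine integral_congr_ae (ae_of_all _ fun x => ?_)
    simp only
    congr 4
    ring
  · refine le_trans (le_of_eq ?_) (setLIntegral_le_lintegral (Ioi 0)ᶜ _)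
    refine setLIntegral_congr_fun measurableSet_Ioi.compl fun ξ hξ => ?_
    simp only [osc, abs_of_nonpos (not_lt.1 hξ : ξ ≤ 0)]
    congr 3
    refine integral_congr_ae (ae_of_all _ fun x => ?_)
    simp only
    congr 4
    ring

lemma le_sq_of_le_mul_rpow {I K : ℝ≥0∞} (hI : I ≠ ∞)
    (h : I ≤ K ^ (1 / 2 : ℝ) * I ^ (3 / 4 : ℝ)) : I ≤ K ^ 2 := by
  rcases eq_or_ne I 0 with h0 | h0
  · simp [h0]
  have h1 : I ^ (3 / 4 : ℝ) ≠ ∞ := ENNReal.rpow_ne_top_of_nonneg (by norm_num) hI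
  have h2 : I ^ (3 / 4 : ℝ) ≠ 0 := by
    rw [Ne, ENNReal.rpow_eq_zero_iff_of_pos (by norm_num)]; exact h0
  have h3 : I = I ^ (1 / 4 : ℝ) * I ^ (3 / 4 : ℝ) := by
    rw [← ENNReal.rpow_add _ _ h0 hI]; norm_num
  have h4 : I ^ (1 / 4 : ℝ) ≤ K ^ (1 / 2 : ℝ) := by
    rw [h3] at h
    rw [← ENNReal.mul_le_mul_iff_left h2 h1]
    convert h using 2
    rw [← h3]
  have h5 := ENNReal.rpow_le_rpow h4 (by norm_num : (0 : ℝ) ≤ 4)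
  rw [← ENNReal.rpow_mul, ← ENNReal.rpow_mul] at h5
  norm_num at h5
  exact h5

/-- Linearised form of the Kenig–Ruiz maximal inequality. -/
lemma lintegral_wave_pow_four_le {a : ℝ → ℂ} (ha : Integrable a) (ham : Measurable a)
    {τ : ℝ → ℝ} (hτ : Measurable τ) :
    ∫⁻ x, ‖wave a x (τ x)‖ₑ ^ 4
      ≤ ((∫⁻ ξ, ENNReal.ofReal |ξ| ^ (1 / 2 : ℝ) * ‖a ξ‖ₑ ^ 2) * dualConst) ^ 2 := by
  set B := ∫⁻ ξ, ENNReal.ofReal |ξ| ^ (1 / 2 : ℝ) * ‖a ξ‖ₑ ^ 2 with hB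
  obtain ⟨W, hW⟩ : ∃ W : ℝ → ℂ, ∀ x, W x = wave a x (τ x) := ⟨_, fun _ => rfl⟩
  have hWm : Measurable W := by
    rw [funext hW]
    exact measurable_wave ha hτ
  have hWb : ∀ x, ‖W x‖ ≤ ∫ ξ, ‖a ξ‖ := fun x => by
    rw [hW]
    exact norm_wave_le a x _
  simp_rw [← hW]
  set M := ∫ ξ, ‖a ξ‖ with hM
  have hM0 : 0 ≤ M := integral_nonneg fun _ => norm_nonneg _
  have hloc : ∀ n : ℕ, ∫⁻ x in Icc (-(n : ℝ)) n, ‖W x‖ₑ ^ 4 ≤ (B * dualConst) ^ 2 := by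
    intro n
    set s := Icc (-(n : ℝ)) n with hs
    have hsm : MeasurableSet s := measurableSet_Icc
    set I := ∫⁻ x in s, ‖W x‖ₑ ^ 4 with hI
    have hIr : IntegrableOn (fun x => ‖W x‖ ^ 4) s := by
      refine Measure.integrableOn_of_bounded (M := M ^ 4) (by simp [hs])
        (by fun_prop) (ae_of_all _ fun x => ?_)
      rw [norm_pow, norm_norm]
      gcongr
      exact hWb x
    have hIeq : I = ENNReal.ofReal (∫ x in s, ‖W x‖ ^ 4) := by
      rw [ofReal_integral_eq_lintegral_ofReal hIr (ae_of_all _ fun x => by positivity), hI]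
      refine lintegral_congr fun x => ?_
      rw [ENNReal.ofReal_pow (norm_nonneg _), ofReal_norm]
    set G : ℝ → ℂ := s.indicator fun x => starRingEnd ℂ (W x) * (‖W x‖ ^ 2 : ℝ) with hGdef
    have hGm : Measurable G := by
      refine Measurable.indicator ?_ hsm
      exact (Complex.continuous_conj.measurable.comp hWm).mul (by fun_prop)
    have hGn : ∀ x, ‖G x‖ = s.indicator (fun x => ‖W x‖ ^ 3) x := by
      intro x
      by_cases hx : x ∈ s
      · simp [hGdef, hx]
        ring
      · simp [hGdef, hx]
    have hGi : Integrable G := by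
      rw [hGdef, integrable_indicator_iff hsm]
      refine Measure.integrableOn_of_bounded (M := M ^ 3) (by simp [hs])
        ((Complex.continuous_conj.measurable.comp hWm).mul (by fun_prop)).aestronglyMeasurable
        (ae_of_all _ fun x => ?_)
      have : ‖starRingEnd ℂ (W x) * ((‖W x‖ ^ 2 : ℝ) : ℂ)‖ = ‖W x‖ ^ 3 := by
        simp
        ring
      rw [this]
      gcongr
      exact hWb x
    have hGp : ∫⁻ x, ‖G x‖ₑ ^ (4 / 3 : ℝ) = I := by
      rw [hI, ← lintegral_indicator hsm]
      refine lintegral_congr fun x => ?_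
      rw [← ofReal_norm, hGn]
      by_cases hx : x ∈ s
      · simp only [indicator_of_mem hx]
        rw [ENNReal.ofReal_pow (norm_nonneg _), ofReal_norm, ← ENNReal.rpow_natCast,
          ← ENNReal.rpow_mul, ← ENNReal.rpow_natCast]
        norm_num
      · simp [hx]
    have hWG : ∫ x, W x * G x = ((∫ x in s, ‖W x‖ ^ 4 : ℝ) : ℂ) := by
      rw [← integral_complex_ofReal, ← integral_indicator hsm]
      refine integral_congr_ae (ae_of_all _ fun x => ?_)
      by_cases hx : x ∈ s
      · simp only [hGdef, indicator_of_mem hx]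
        rw [← mul_assoc, Complex.mul_conj']
        push_cast
        ring
      · simp [hGdef, hx]
    have hFub : ∫ x, W x * G x = ∫ ξ, a ξ * ∫ x, osc x (τ x) ξ * G x := by
      have h1 : ∀ x, W x * G x = ∫ ξ, osc x (τ x) ξ * (G x * a ξ) := fun x => by
        rw [hW]
        simp only [wave]
        rw [← integral_mul_const]
        congr 1
        funext ξ
        ring
      have h2 : ∀ ξ, a ξ * ∫ x, osc x (τ x) ξ * G x = ∫ x, osc x (τ x) ξ * (G x * a ξ) :=
        fun ξ => by
          rw [← integral_const_mul]
          congr 1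
          funext x
          ring
      simp_rw [h1, h2]
      refine integral_integral_swap ?_
      refine (hGi.mul_prod ha).bdd_mul (c := 1) (Measurable.aestronglyMeasurable ?_)
        (ae_of_all _ fun p => (norm_osc _ _ _).le)
      fun_prop
    have hSm : Measurable fun ξ => ∫ x, osc x (τ x) ξ * G x := by
      refine StronglyMeasurable.measurable ?_
      refine StronglyMeasurable.integral_prod_right' (f := fun p : ℝ × ℝ =>
        osc p.2 (τ p.2) p.1 * G p.2) (Measurable.stronglyMeasurable ?_)
      fun_prop
    refine le_sq_of_le_mul_rpow (by rw [hIeq]; exact ENNReal.ofReal_ne_top) ?_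
    calc I = ‖∫ x, W x * G x‖ₑ := by
          rw [hWG, hIeq, ← ofReal_norm, Complex.norm_real, Real.norm_of_nonneg]
          exact integral_nonneg fun x => by positivity
      _ ≤ ∫⁻ ξ, ‖a ξ * ∫ x, osc x (τ x) ξ * G x‖ₑ := by
          rw [hFub]
          exact enorm_integral_le_lintegral_enorm _
      _ ≤ ∫⁻ ξ, ((fun ξ => ENNReal.ofReal |ξ| ^ (1 / 4 : ℝ) * ‖a ξ‖ₑ) *
            fun ξ => rieszKernel ξ ^ (1 / 2 : ℝ) * ‖∫ x, osc x (τ x) ξ * G x‖ₑ) ξ := by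
          refine lintegral_mono_ae ?_
          filter_upwards [compl_mem_ae_iff.2 (measure_singleton (0 : ℝ))] with ξ hξ
          have hξ0 : ENNReal.ofReal |ξ| ≠ 0 := by
            have : 0 < |ξ| := abs_pos.2 hξ
            simpa using hξ
          have : ENNReal.ofReal |ξ| ^ (1 / 4 : ℝ) * rieszKernel ξ ^ (1 / 2 : ℝ) = 1 := by
            rw [rieszKernel, ← ENNReal.rpow_mul, ← ENNReal.rpow_add _ _ hξ0 ENNReal.ofReal_ne_top]
            norm_num
          rw [Pi.mul_apply, mul_mul_mul_comm, this, one_mul, enorm_mul]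
      _ ≤ _ := ENNReal.lintegral_mul_le_Lp_mul_Lq volume (p := 2) (q := 2)
            (Real.holderConjugate_iff.2 ⟨by norm_num, by norm_num⟩)
            (Measurable.aemeasurable (by fun_prop)) (Measurable.aemeasurable (by fun_prop))
      _ ≤ B ^ (1 / 2 : ℝ) * (dualConst * I ^ (3 / 2 : ℝ)) ^ (1 / 2 : ℝ) := by
          refine mul_le_mul' (ENNReal.rpow_le_rpow (le_of_eq ?_) (by norm_num))
            (ENNReal.rpow_le_rpow ?_ (by norm_num))
          · rw [hB]
            refine lintegral_congr fun ξ => ?_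
            rw [ENNReal.mul_rpow_of_nonneg _ _ (by norm_num), ← ENNReal.rpow_mul]
            norm_num
          · rw [← hGp]
            refine le_trans (le_of_eq ?_) (lintegral_rieszKernel_mul_dual_le hGi hGm hτ)
            refine lintegral_congr fun ξ => ?_
            rw [ENNReal.mul_rpow_of_nonneg _ _ (by norm_num), ← ENNReal.rpow_mul]
            norm_num
      _ = _ := by
          rw [ENNReal.mul_rpow_of_nonneg _ _ (by norm_num),
            ENNReal.mul_rpow_of_nonneg _ _ (by norm_num), ← ENNReal.rpow_mul, mul_assoc]
          norm_num
  have hmono : Monotone fun n : ℕ => Icc (-(n : ℝ)) n := fun m n hmn => by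
    have : (m : ℝ) ≤ n := by exact_mod_cast hmn
    exact Icc_subset_Icc (by linarith) this
  have hun : ⋃ n : ℕ, Icc (-(n : ℝ)) n = univ := by
    refine eq_univ_of_forall fun x => mem_iUnion.2 ?_
    obtain ⟨n, hn⟩ := exists_nat_ge |x|
    exact ⟨n, by rw [mem_Icc, ← abs_le]; exact hn⟩
  have := setLIntegral_iUnion_of_directed (μ := volume) (fun x => ‖W x‖ₑ ^ 4)
    (hmono.directed_le)
  rw [hun, setLIntegral_univ] at this
  rw [this]
  exact iSup_le hloc

/-- Kenig–Ruiz maximal inequality. -/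
lemma exists_wave_maximal {a : ℝ → ℂ} (ha : Integrable a) (ham : Measurable a) :
    ∃ S : ℝ → ℝ≥0∞, (∀ x t, ‖wave a x t‖ₑ ^ 4 ≤ S x) ∧
      ∫⁻ x, S x ≤ ((∫⁻ ξ, ENNReal.ofReal |ξ| ^ (1 / 2 : ℝ) * ‖a ξ‖ₑ ^ 2) * dualConst) ^ 2 := by
  set q : ℕ → ℝ := TopologicalSpace.denseSeq ℝ
  set u : ℕ → ℝ → ℝ≥0∞ := fun n x => ‖wave a x (q n)‖ₑ ^ 4 with hu
  have hc := continuous_wave ha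
  have hum : ∀ n, Measurable (u n) := fun n =>
    ((hc.comp (by fun_prop : Continuous fun x : ℝ => (x, q n))).measurable.enorm).pow_const _
  have hsel : ∀ N, ∃ τ : ℝ → ℝ, Measurable τ ∧ ∀ x, partialSups u N x ≤ ‖wave a x (τ x)‖ₑ ^ 4 := by
    intro N
    induction N with
    | zero => exact ⟨fun _ => q 0, measurable_const, fun x => by simp [hu]⟩
    | succ N ih =>
      obtain ⟨τ, hτ, h⟩ := ih
      have hτm : Measurable fun x => ‖wave a x (τ x)‖ₑ ^ 4 :=
        (measurable_wave ha hτ).enorm.pow_const _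
      refine ⟨fun x => if ‖wave a x (τ x)‖ₑ ^ 4 ≤ u (N + 1) x then q (N + 1) else τ x,
        Measurable.ite (measurableSet_le hτm (hum _)) measurable_const hτ, fun x => ?_⟩
      rw [partialSups_add_one, Pi.sup_apply]
      by_cases hx : ‖wave a x (τ x)‖ₑ ^ 4 ≤ u (N + 1) x
      · simp only [hx, if_true]
        exact sup_le ((h x).trans hx) le_rfl
      · simp only [hx, if_false]
        exact sup_le (h x) (not_le.1 hx).le
  refine ⟨fun x => ⨆ N, partialSups u N x, fun x t => ?_, ?_⟩
  · have hcl : IsClosed {t | ‖wave a x t‖ₑ ^ 4 ≤ ⨆ N, partialSups u N x} := by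
      refine isClosed_le ?_ continuous_const
      exact (ENNReal.continuous_pow 4).comp
        (hc.comp (by fun_prop : Continuous fun t : ℝ => (x, t))).enorm
    have hsub : closure (range q) ⊆ {t | ‖wave a x t‖ₑ ^ 4 ≤ ⨆ N, partialSups u N x} := by
      refine closure_minimal ?_ hcl
      rintro _ ⟨n, rfl⟩
      exact le_trans (le_partialSups u n x) (le_iSup (fun N => partialSups u N x) n)
    exact hsub (TopologicalSpace.denseRange_denseSeq ℝ t)
  · rw [lintegral_iSup]
    · refine iSup_le fun N => ?_
      obtain ⟨τ, hτ, h⟩ := hsel N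
      exact (lintegral_mono h).trans (lintegral_wave_pow_four_le ha ham hτ)
    · intro N
      induction N with
      | zero => simpa using hum 0
      | succ N ih =>
        rw [partialSups_add_one]
        exact ih.sup (hum _)
    · exact fun m n hmn x => (partialSups u).monotone hmn x

lemma hasDerivAt_mul_abs (x : ℝ) : HasDerivAt (fun ξ : ℝ => ξ * |ξ|) (2 * |x|) x := by
  rcases lt_trichotomy x 0 with h | rfl | h
  · convert! (hasDerivAt_id x).mul (hasDerivAt_abs_neg h) using 1
    simp [abs_of_neg h]
    ring
  · rw [hasDerivAt_iff_tendsto_slope]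
    have : Tendsto (fun y : ℝ => |y|) (𝓝[≠] 0) (𝓝 (2 * |(0 : ℝ)|)) := by
      simpa using (continuous_abs.tendsto (0 : ℝ)).mono_left nhdsWithin_le_nhds
    refine this.congr' ?_
    filter_upwards [self_mem_nhdsWithin] with y hy
    rw [slope_def_field]
    field_simp [show y ≠ 0 from hy]
    simp
  · convert! (hasDerivAt_id x).mul (hasDerivAt_abs_pos h) using 1
    simp [abs_of_pos h]
    ring

lemma strictMono_mul_abs : StrictMono fun ξ : ℝ => ξ * |ξ| := by
  intro x y h
  simp only
  rcases abs_cases x with ⟨h1, h2⟩ | ⟨h1, h2⟩ <;> rcases abs_cases y with ⟨h3, h4⟩ | ⟨h3, h4⟩ <;>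
    rw [h1, h3] <;> nlinarith

lemma lintegral_abs_mul_comp_le (g : ℝ → ℝ≥0∞) :
    ∫⁻ ξ : ℝ, ENNReal.ofReal |ξ| * g (ξ * |ξ|) ≤ ∫⁻ y, g y := by
  have h := lintegral_image_eq_lintegral_abs_deriv_mul MeasurableSet.univ
    (fun x _ => (hasDerivAt_mul_abs x).hasDerivWithinAt) strictMono_mul_abs.injective.injOn g
  refine le_trans ?_ (setLIntegral_le_lintegral ((fun ξ : ℝ => ξ * |ξ|) '' univ) g)
  rw [h, setLIntegral_univ]
  refine lintegral_mono fun ξ => mul_le_mul_left (ENNReal.ofReal_le_ofReal ?_) _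
  rw [abs_mul, abs_abs, abs_two]
  linarith [abs_nonneg ξ]

/-- Schur test for a symmetric kernel, with weights. -/
lemma lintegral_lintegral_mul_le_of_symm {m w : ℝ → ℝ≥0∞} (hm : Measurable m) (hw : Measurable w)
    {K : ℝ → ℝ → ℝ≥0∞} (hK : Measurable (Function.uncurry K)) (hsymm : ∀ x y, K x y = K y x)
    {A : ℝ≥0∞} (hA : ∀ x, ∫⁻ y, w y * K x y ≤ A) :
    ∫⁻ x, ∫⁻ y, (w x ^ (1 / 2 : ℝ) * m x) * (w y ^ (1 / 2 : ℝ) * m y) * K x y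
      ≤ 2 * A * ∫⁻ x, m x ^ 2 := by
  have hsq : ∀ x, (w x ^ (1 / 2 : ℝ)) ^ 2 = w x := fun x => by
    rw [← ENNReal.rpow_natCast, ← ENNReal.rpow_mul]
    norm_num
  have hpt : ∀ x y, (w x ^ (1 / 2 : ℝ) * m x) * (w y ^ (1 / 2 : ℝ) * m y) * K x y
      ≤ m x ^ 2 * (w y * K x y) + m y ^ 2 * (w x * K x y) := by
    intro x y
    have h : ∀ p q : ℝ≥0∞, p * q ≤ p ^ 2 + q ^ 2 := fun p q => by
      rcases le_total p q with h | h
      · exact (mul_le_mul_left h q).trans (by rw [← sq]; exact le_add_self)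
      · exact (mul_le_mul_right h p).trans (by rw [← sq]; exact le_self_add)
    have h1 := mul_le_mul_left (h (w y ^ (1 / 2 : ℝ) * m x) (w x ^ (1 / 2 : ℝ) * m y)) (K x y)
    rw [mul_pow, mul_pow, hsq, hsq] at h1
    calc _ = w y ^ (1 / 2 : ℝ) * m x * (w x ^ (1 / 2 : ℝ) * m y) * K x y := by ring
      _ ≤ _ := h1
      _ = _ := by ring
  have hK1 : Measurable fun p : ℝ × ℝ => m p.1 ^ 2 * (w p.2 * K p.1 p.2) := by
    have : Measurable fun p : ℝ × ℝ => K p.1 p.2 := hK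
    fun_prop
  have hK2 : Measurable fun p : ℝ × ℝ => m p.2 ^ 2 * (w p.1 * K p.1 p.2) := by
    have : Measurable fun p : ℝ × ℝ => K p.1 p.2 := hK
    fun_prop
  have hKs : ∀ x, Measurable (K x) := fun x => hK.comp (by fun_prop : Measurable fun y => (x, y))
  have hbound : ∫⁻ x, ∫⁻ y, m x ^ 2 * (w y * K x y) ≤ A * ∫⁻ x, m x ^ 2 := by
    rw [← lintegral_const_mul _ (by fun_prop)]
    refine lintegral_mono fun x => ?_
    have hwK : Measurable fun y => w y * K x y := hw.mul (hKs x)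
    rw [lintegral_const_mul _ hwK, mul_comm]
    exact mul_le_mul_left (hA x) _
  calc _ ≤ ∫⁻ x, ∫⁻ y, (m x ^ 2 * (w y * K x y) + m y ^ 2 * (w x * K x y)) :=
        lintegral_mono fun x => lintegral_mono fun y => hpt x y
    _ = (∫⁻ x, ∫⁻ y, m x ^ 2 * (w y * K x y)) + ∫⁻ x, ∫⁻ y, m y ^ 2 * (w x * K x y) := by
        rw [← lintegral_add_left hK1.lintegral_prod_right']
        refine lintegral_congr fun x => ?_
        rw [lintegral_add_left]
        exact hK1.comp (by fun_prop : Measurable fun y : ℝ => (x, y))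
    _ = (∫⁻ x, ∫⁻ y, m x ^ 2 * (w y * K x y)) + ∫⁻ y, ∫⁻ x, m y ^ 2 * (w x * K y x) := by
        congr 1
        rw [lintegral_lintegral_swap hK2.aemeasurable]
        simp_rw [fun x y => hsymm y x]
    _ ≤ A * (∫⁻ x, m x ^ 2) + A * ∫⁻ x, m x ^ 2 := add_le_add hbound hbound
    _ = _ := by ring

lemma gaussKernel_zero_right {l : ℝ} (hl : 0 < l) (a : ℝ) :
    gaussKernel l a 0 = √(π / l) * rexp (-(1 / (4 * l)) * a ^ 2) := by
  unfold gaussKernel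
  have h1 : (l ^ 2 + 0 ^ 2) ^ (-(1 / 4) : ℝ) = (√l)⁻¹ := by
    rw [zero_pow two_ne_zero, add_zero, ← rpow_natCast, ← rpow_mul hl.le, sqrt_eq_rpow,
      ← rpow_neg hl.le]
    norm_num
  rw [h1, sqrt_div' _ hl.le, div_eq_mul_inv]
  congr 2
  field_simp
  ring

lemma measurable_gaussKernel_zero (l : ℝ) :
    Measurable fun a => ENNReal.ofReal (gaussKernel l a 0) := by
  unfold gaussKernel
  fun_prop

lemma lintegral_ofReal_gaussian {b : ℝ} (hb : 0 < b) :
    ∫⁻ y : ℝ, ENNReal.ofReal (rexp (-b * y ^ 2)) = ENNReal.ofReal √(π / b) := by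
  rw [← integral_gaussian, ofReal_integral_eq_lintegral_ofReal (integrable_exp_neg_mul_sq hb)
    (ae_of_all _ fun x => (exp_pos _).le)]

lemma lintegral_gaussKernel_zero {l : ℝ} (hl : 0 < l) (c : ℝ) :
    ∫⁻ y : ℝ, ENNReal.ofReal (gaussKernel l (c - y) 0) = ENNReal.ofReal (2 * π) := by
  have h : ∀ y : ℝ, ENNReal.ofReal (gaussKernel l (c - y) 0) = ENNReal.ofReal √(π / l) *
      ENNReal.ofReal (rexp (-(1 / (4 * l)) * (c - y) ^ 2)) := fun y => by
    rw [gaussKernel_zero_right hl, ENNReal.ofReal_mul (sqrt_nonneg _)]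
  simp_rw [h]
  rw [lintegral_const_mul _ (by fun_prop),
    lintegral_sub_left_eq_self (fun y => ENNReal.ofReal (rexp (-(1 / (4 * l)) * y ^ 2))) c,
    lintegral_ofReal_gaussian (by positivity), ← ENNReal.ofReal_mul (sqrt_nonneg _),
    ← sqrt_mul (by positivity)]
  congr 1
  rw [sqrt_eq_iff_mul_self_eq (by positivity) (by positivity)]
  field_simp
  ring

lemma gaussKernel_neg_left (l a b : ℝ) : gaussKernel l (-a) b = gaussKernel l a b := by
  simp [gaussKernel]

/-- Kato smoothing. -/
lemma lintegral_wave_time_le {a : ℝ → ℂ} (ha : Integrable a) {m : ℝ → ℝ≥0∞} (hm : Measurable m)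
    (ham : ∀ ξ, ‖a ξ‖ₑ = ENNReal.ofReal |ξ| ^ (1 / 2 : ℝ) * m ξ) (x : ℝ) {T : ℝ} (hT : T ≤ 1) :
    ∫⁻ t in Ioc 0 T, ‖wave a x t‖ₑ ^ 2
      ≤ ENNReal.ofReal (rexp 1 * (4 * π)) * ∫⁻ ξ, m ξ ^ 2 := by
  have hω : Measurable fun ξ : ℝ => ξ * |ξ| := by fun_prop
  have key := lintegral_gaussian_mul_enorm_sq_le (integrable_osc_mul ha x 0) hω
    (measurable_const (a := (0 : ℝ))) one_pos
  have hw : ∀ t, ∫ ξ, Complex.exp (Complex.I * ((t * (ξ * |ξ|) + t ^ 2 * 0 : ℝ) : ℂ)) *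
      (osc x 0 ξ * a ξ) = wave a x t := fun t => by
    unfold wave
    congr 1
    funext ξ
    rw [← mul_assoc, osc, osc, ← Complex.exp_add]
    congr 2
    push_cast
    ring
  simp_rw [hw] at key
  calc ∫⁻ t in Ioc 0 T, ‖wave a x t‖ₑ ^ 2
      ≤ ∫⁻ t in Ioc 0 T, ENNReal.ofReal (rexp 1) *
          (ENNReal.ofReal (rexp (-1 * t ^ 2)) * ‖wave a x t‖ₑ ^ 2) := by
        refine setLIntegral_mono' measurableSet_Ioc fun t ht => ?_
        rw [← mul_assoc, ← ENNReal.ofReal_mul (exp_pos _).le, ← exp_add]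
        refine le_mul_of_one_le_left' ?_
        rw [ENNReal.one_le_ofReal]
        refine one_le_exp ?_
        nlinarith [ht.1, ht.2]
    _ ≤ ∫⁻ t, ENNReal.ofReal (rexp 1) *
          (ENNReal.ofReal (rexp (-1 * t ^ 2)) * ‖wave a x t‖ₑ ^ 2) := setLIntegral_le_lintegral _ _
    _ = ENNReal.ofReal (rexp 1) *
          ∫⁻ t, (ENNReal.ofReal (rexp (-1 * t ^ 2)) * ‖wave a x t‖ₑ ^ 2) := by
        rw [lintegral_const_mul']
        exact ENNReal.ofReal_ne_top
    _ ≤ ENNReal.ofReal (rexp 1) * (2 * ENNReal.ofReal (2 * π) * ∫⁻ ξ, m ξ ^ 2) := by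
        refine mul_le_mul_right (key.trans ?_) _
        simp_rw [enorm_mul, ← ofReal_norm (osc _ _ _), norm_osc, ENNReal.ofReal_one, one_mul, ham,
          sub_zero]
        refine lintegral_lintegral_mul_le_of_symm hm (w := fun ξ => ENNReal.ofReal |ξ|)
          (by fun_prop) (K := fun ξ ζ => ENNReal.ofReal (gaussKernel 1 (ξ * |ξ| - ζ * |ζ|) 0))
          ((measurable_gaussKernel_zero 1).comp (by fun_prop)) (fun ξ ζ => ?_) fun ξ => ?_
        · rw [← gaussKernel_neg_left, neg_sub]
        · refine (lintegral_abs_mul_comp_le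
            fun y => ENNReal.ofReal (gaussKernel 1 (ξ * |ξ| - y) 0)).trans (le_of_eq ?_)
          exact lintegral_gaussKernel_zero one_pos _
    _ = _ := by
        rw [← mul_assoc, ← ENNReal.ofReal_ofNat, ← ENNReal.ofReal_mul (by norm_num),
          ← ENNReal.ofReal_mul (exp_pos _).le]
        congr 2
        ring

/-- `L²` boundedness of the Fourier transform on integrable functions. -/
lemma lintegral_wave_space_le {a : ℝ → ℂ} (ha : Integrable a) (ham : Measurable a) (t : ℝ) :
    ∫⁻ x, ‖wave a x t‖ₑ ^ 2 ≤ 2 * ∫⁻ ξ, ‖a ξ‖ₑ ^ 2 := by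
  have hG := integrable_osc_mul ha 0 t
  have hl : ∀ n : ℕ, (0 : ℝ) < 1 / (n + 1) := fun n => by positivity
  have hw : ∀ x, ∫ ξ, Complex.exp (Complex.I * ((x * (2 * π * ξ) + x ^ 2 * 0 : ℝ) : ℂ)) *
      (osc 0 t ξ * a ξ) = wave a x t := fun t => by
    unfold wave
    congr 1
    funext ξ
    rw [← mul_assoc, osc, osc, ← Complex.exp_add]
    congr 2
    push_cast
    ring
  have key : ∀ n : ℕ, ∫⁻ x : ℝ, ENNReal.ofReal (rexp (-(1 / ((n : ℝ) + 1)) * x ^ 2)) *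
      ‖wave a x t‖ₑ ^ 2 ≤ 2 * ∫⁻ ξ, ‖a ξ‖ₑ ^ 2 := by
    intro n
    have := lintegral_gaussian_mul_enorm_sq_le hG (α := fun ξ => 2 * π * ξ) (by fun_prop)
      (measurable_const (a := (0 : ℝ))) (hl n)
    simp_rw [hw] at this
    refine this.trans ?_
    simp_rw [enorm_mul, ← ofReal_norm (osc _ _ _), norm_osc, ENNReal.ofReal_one, one_mul, sub_zero]
    have := lintegral_lintegral_mul_le_of_symm ham.enorm (w := fun _ => 1) measurable_const
      (K := fun ξ ζ => ENNReal.ofReal (gaussKernel (1 / ((n : ℝ) + 1)) (2 * π * ξ - 2 * π * ζ) 0))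
      ((measurable_gaussKernel_zero _).comp (by fun_prop)) (fun ξ ζ => ?_) (A := 1) fun ξ => ?_
    · simpa using this
    · rw [← gaussKernel_neg_left, neg_sub]
    · have hpi : (0 : ℝ) < 2 * π := by positivity
      simp_rw [one_mul, ← mul_sub]
      have h := lintegral_sub_left_eq_self (μ := volume) (fun y => ENNReal.ofReal
        (gaussKernel (1 / ((n : ℝ) + 1)) (2 * π * y) 0)) ξ
      rw [h]
      rw [← lintegral_map (f := fun y => ENNReal.ofReal (gaussKernel (1 / ((n : ℝ) + 1)) y 0))
        (measurable_gaussKernel_zero _) (measurable_const_mul (2 * π)),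
        Real.map_volume_mul_left hpi.ne', lintegral_smul_measure, smul_eq_mul]
      have h3 := lintegral_gaussKernel_zero (hl n) 0
      simp_rw [zero_sub, gaussKernel_neg_left] at h3
      rw [h3, abs_of_pos (inv_pos.2 hpi), ← ENNReal.ofReal_mul (inv_pos.2 hpi).le,
        inv_mul_cancel₀ hpi.ne']
      simp
  have hm : Measurable fun x => ‖wave a x t‖ₑ ^ 2 :=
    (measurable_wave ha measurable_const).enorm.pow_const 2
  have hlim : ∀ x : ℝ, Tendsto (fun n : ℕ => ENNReal.ofReal (rexp (-(1 / ((n : ℝ) + 1)) * x ^ 2)) *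
      ‖wave a x t‖ₑ ^ 2) atTop (𝓝 (‖wave a x t‖ₑ ^ 2)) := by
    intro x
    have h1 : Tendsto (fun n : ℕ => rexp (-(1 / ((n : ℝ) + 1)) * x ^ 2)) atTop (𝓝 1) := by
      have := (tendsto_one_div_add_atTop_nhds_zero_nat (𝕜 := ℝ)).neg.mul_const (x ^ 2)
      simpa [Function.comp_def] using (continuous_exp.tendsto _).comp this
    have h2 := ENNReal.Tendsto.mul_const (b := ‖wave a x t‖ₑ ^ 2) (ENNReal.tendsto_ofReal h1)
      (Or.inl (by simp))
    simpa using h2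
  calc ∫⁻ x, ‖wave a x t‖ₑ ^ 2 = ∫⁻ x, liminf (fun n : ℕ =>
        ENNReal.ofReal (rexp (-(1 / ((n : ℝ) + 1)) * x ^ 2)) * ‖wave a x t‖ₑ ^ 2) atTop :=
        lintegral_congr fun x => (hlim x).liminf_eq.symm
    _ ≤ _ := lintegral_liminf_le fun n => by fun_prop
    _ ≤ _ := liminf_le_of_le (by isBoundedDefault) fun b hb => by
        obtain ⟨n, hn⟩ := hb.exists
        exact hn.trans (key n)

lemma fourierInv_exp_mul_eq_wave (a : ℝ → ℂ) (x t : ℝ) :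
    𝓕⁻ (fun ξ => a ξ * Complex.exp (Complex.I * (t * ξ * |ξ|))) x = wave a x t := by
  rw [Real.fourierInv_eq', wave]
  congr 1
  funext ξ
  rw [smul_eq_mul, mul_left_comm, ← Complex.exp_add, mul_comm, osc]
  congr 2
  simp only [RCLike.inner_apply, conj_trivial]
  push_cast
  ring

lemma fourier_eq_wave (h : ℝ → ℂ) (x : ℝ) : 𝓕 h x = wave h (-x) 0 := by
  rw [← fourierInv_exp_mul_eq_wave, Real.fourierInv_eq_fourier_neg, neg_neg]
  simp

lemma lintegral_fourier_sq_le {h : ℝ → ℂ} (hh : Integrable h) (hm : Measurable h) :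
    ∫⁻ x, ‖𝓕 h x‖ₑ ^ 2 ≤ 2 * ∫⁻ ξ, ‖h ξ‖ₑ ^ 2 := by
  simp_rw [fourier_eq_wave]
  rw [lintegral_neg_eq_self (fun x => ‖wave h x 0‖ₑ ^ 2)]
  exact lintegral_wave_space_le hh hm 0

lemma continuous_fourier_of_integrable {h : ℝ → ℂ} (hh : Integrable h) : Continuous (𝓕 h) := by
  rw [funext (fourier_eq_wave h)]
  exact (continuous_wave hh).comp (by fun_prop : Continuous fun x : ℝ => (-x, (0 : ℝ)))

lemma integrable_fourier_sq {h : ℝ → ℂ} (hh : Integrable h) (hm : Measurable h) {M : ℝ}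
    (hM : ∀ ξ, ‖h ξ‖ ≤ M) : Integrable fun x => ‖𝓕 h x‖ ^ 2 := by
  have hM0 : 0 ≤ M := (norm_nonneg _).trans (hM 0)
  refine ⟨((continuous_fourier_of_integrable hh).norm.pow 2).aestronglyMeasurable, ?_⟩
  have h1 : Integrable fun ξ => ‖h ξ‖ ^ 2 := by
    refine (hh.norm.const_mul M).mono' (hm.norm.pow_const 2).aestronglyMeasurable
      (ae_of_all _ fun ξ => ?_)
    rw [norm_pow, norm_norm, sq]
    exact mul_le_mul_of_nonneg_right (hM ξ) (norm_nonneg _)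
  have h2 : ∫⁻ ξ, ‖h ξ‖ₑ ^ 2 < ∞ := by
    refine lt_of_eq_of_lt (lintegral_congr fun ξ => ?_) h1.2
    rw [enorm_pow, enorm_norm]
  refine lt_of_eq_of_lt (lintegral_congr fun x => ?_)
    ((lintegral_fourier_sq_le hh hm).trans_lt (ENNReal.mul_lt_top (by simp) h2))
  rw [enorm_pow, enorm_norm]

lemma integrable_fourier_of_deriv {g : ℝ → ℂ} (hg : Integrable g) (hd : Differentiable ℝ g)
    (hg' : Integrable (deriv g)) {M : ℝ} (hM : ∀ ξ, ‖g ξ‖ ≤ M) (hM' : ∀ ξ, ‖deriv g ξ‖ ≤ M) :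
    Integrable (𝓕 g) := by
  have h1 := integrable_fourier_sq hg hd.continuous.measurable hM
  have h2 := integrable_fourier_sq hg' (measurable_deriv g) hM'
  rw [Real.fourier_deriv hg hd hg'] at h2
  refine ((integrable_inv_one_add_sq.add h1).add h2).mono'
    (continuous_fourier_of_integrable hg).aestronglyMeasurable (ae_of_all _ fun x => ?_)
  have h3 : ‖(2 * (π : ℂ) * Complex.I * x) • 𝓕 g x‖ ^ 2 = (2 * π) ^ 2 * (x ^ 2 * ‖𝓕 g x‖ ^ 2) := by
    rw [norm_smul]
    simp [abs_of_pos pi_pos, mul_pow]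
    ring
  simp only [Pi.add_apply, h3]
  set y := ‖𝓕 g x‖ with hy
  have hy0 : 0 ≤ y := norm_nonneg _
  have h4 : (1 : ℝ) ≤ (2 * π) ^ 2 := one_le_pow₀ (by nlinarith [pi_gt_three])
  have h5 : x ^ 2 * y ^ 2 ≤ (2 * π) ^ 2 * (x ^ 2 * y ^ 2) :=
    le_mul_of_one_le_left (by positivity) h4
  have h6 : y ≤ (1 + x ^ 2)⁻¹ + (1 + x ^ 2) * y ^ 2 := by
    have hp : 0 < 1 + x ^ 2 := by positivity
    have h7 : 0 ≤ ((1 + x ^ 2)⁻¹ - y) ^ 2 * (1 + x ^ 2) := by positivity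
    have h8 : ((1 + x ^ 2)⁻¹ - y) ^ 2 * (1 + x ^ 2) =
        (1 + x ^ 2)⁻¹ + (1 + x ^ 2) * y ^ 2 - 2 * y := by
      field_simp
      ring
    linarith
  linarith

/-- The profile `e^{itξ|ξ|} f(ξ)` of the free evolution. -/
def profile (f : ℝ → ℂ) (t ξ : ℝ) : ℂ := Complex.exp (Complex.I * (t * ξ * |ξ|)) * f ξ

lemma norm_exp_I_mul_abs (t ξ : ℝ) : ‖Complex.exp (Complex.I * (t * ξ * |ξ|))‖ = 1 := by
  rw [← Complex.ofReal_mul, ← Complex.ofReal_mul]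
  exact Complex.norm_exp_I_mul_ofReal _

lemma norm_profile (f : ℝ → ℂ) (t ξ : ℝ) : ‖profile f t ξ‖ = ‖f ξ‖ := by
  rw [profile, norm_mul, norm_exp_I_mul_abs, one_mul]

lemma hasDerivAt_profile (f : SchwartzMap ℝ ℂ) (t ξ : ℝ) :
    HasDerivAt (profile f t) (Complex.exp (Complex.I * (t * ξ * |ξ|)) *
      (Complex.I * (t * (2 * |ξ|)) * f ξ + deriv f ξ)) ξ := by
  have h1 : HasDerivAt (fun ξ : ℝ => Complex.I * (t * ξ * |ξ|)) (Complex.I * (t * (2 * |ξ|))) ξ := by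
    have := (((hasDerivAt_mul_abs ξ).ofReal_comp).const_mul (t : ℂ)).const_mul Complex.I
    convert! this using 1
    · funext y
      push_cast
      ring
    · push_cast
      ring
  have h2 := h1.cexp.mul (f.differentiableAt (x := ξ)).hasDerivAt
  convert! h2 using 1
  ring

lemma fourier_BOGroup (φ : SchwartzMap ℝ ℂ) (t : ℝ) :
    𝓕 (BOGroup t φ) = profile (𝓕 φ : SchwartzMap ℝ ℂ) t := by
  have hB : BOGroup t φ = 𝓕⁻ (profile (𝓕 φ : SchwartzMap ℝ ℂ) t) := by
    unfold BOGroup FMul profile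
    rw [SchwartzMap.fourier_coe]
  rw [hB]
  set f : SchwartzMap ℝ ℂ := 𝓕 φ
  have hd : Differentiable ℝ (profile f t) := fun ξ => (hasDerivAt_profile f t ξ).differentiableAt
  have hc := hd.continuous
  have hi : Integrable (profile f t) := by
    refine f.integrable.norm.mono' hc.aestronglyMeasurable (ae_of_all _ fun ξ => ?_)
    rw [norm_profile]
  have hderiv : ∀ ξ, ‖deriv (profile f t) ξ‖ ≤ 2 * |t| * (‖ξ‖ ^ 1 * ‖f ξ‖) +
      ‖SchwartzMap.derivCLM ℂ ℂ f ξ‖ := fun ξ => by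
    rw [(hasDerivAt_profile f t ξ).deriv, norm_mul, norm_exp_I_mul_abs, one_mul,
      SchwartzMap.derivCLM_apply]
    refine (norm_add_le _ _).trans (le_of_eq ?_)
    simp
    ring
  have hi' : Integrable (deriv (profile f t)) := by
    refine (((f.integrable_pow_mul volume 1).const_mul (2 * |t|)).add
      (SchwartzMap.derivCLM ℂ ℂ f).integrable.norm).mono'
      (measurable_deriv _).aestronglyMeasurable (ae_of_all _ hderiv)
  obtain ⟨C, -, hC⟩ := f.decay 1 0
  have hC : ∀ ξ : ℝ, ‖ξ‖ ^ 1 * ‖f ξ‖ ≤ C := fun ξ => by simpa using hC ξ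
  have h1 := SchwartzMap.norm_le_seminorm ℂ f
  have h2 := SchwartzMap.norm_le_seminorm ℂ (SchwartzMap.derivCLM ℂ ℂ f)
  refine Continuous.fourier_fourierInv_eq hc hi (integrable_fourier_of_deriv hi hd hi'
    (M := max (SchwartzMap.seminorm ℂ 0 0 f) (2 * |t| * C +
      SchwartzMap.seminorm ℂ 0 0 (SchwartzMap.derivCLM ℂ ℂ f))) (fun ξ => ?_) fun ξ => ?_)
  · rw [norm_profile]
    exact (h1 ξ).trans (le_max_left _ _)
  · refine ((hderiv ξ).trans ?_).trans (le_max_right _ _)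
    exact add_le_add (mul_le_mul_of_nonneg_left (hC ξ) (by positivity)) (h2 ξ)

lemma HsNorm_BOGroup (φ : SchwartzMap ℝ ℂ) (s t : ℝ) : HsNorm s (BOGroup t φ) = HsNorm s φ := by
  unfold HsNorm
  refine eLpNorm_congr_norm_ae (ae_of_all _ fun ξ => ?_)
  rw [fourier_BOGroup, norm_mul, norm_mul, norm_profile, SchwartzMap.fourier_coe]

lemma FMul_BOGroup (m : ℝ → ℂ) (φ : SchwartzMap ℝ ℂ) (x t : ℝ) :
    FMul m (BOGroup t φ) x = wave (fun ξ => m ξ * (𝓕 φ : SchwartzMap ℝ ℂ) ξ) x t := by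
  rw [← fourierInv_exp_mul_eq_wave, FMul, fourier_BOGroup]
  refine congrFun (congrArg _ (funext fun ξ => ?_)) x
  rw [profile]
  ring

lemma integrable_abs_rpow_mul {α : ℝ} (h1 : -1 < α) (h2 : α ≤ 1) (f : SchwartzMap ℝ ℂ) :
    Integrable fun ξ : ℝ => ((|ξ| ^ α : ℝ) : ℂ) * f ξ := by
  set b : ℝ → ℝ := (Iic 1).indicator fun z => z ^ α with hb
  have hbm : Measurable b := Measurable.indicator (by fun_prop) measurableSet_Iic
  have hbi : IntegrableOn b (Ioi 0) := by
    rw [hb, IntegrableOn, integrable_indicator_iff measurableSet_Iic, IntegrableOn,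
      Measure.restrict_restrict measurableSet_Iic, inter_comm, Ioi_inter_Iic]
    have := intervalIntegral.intervalIntegrable_rpow' (a := 0) (b := 1) h1
    rwa [intervalIntegrable_iff_integrableOn_Ioc_of_le zero_le_one] at this
  have hba : Integrable fun ξ : ℝ => b |ξ| := by
    refine ⟨Measurable.aestronglyMeasurable (by fun_prop), ?_⟩
    have h := lintegral_comp_abs_eq fun z => ‖b z‖ₑ
    exact lt_of_eq_of_lt h (ENNReal.mul_lt_top (by simp) hbi.2)
  obtain ⟨M, hM⟩ : ∃ M, ∀ ξ, ‖f ξ‖ ≤ M := ⟨_, SchwartzMap.norm_le_seminorm ℂ f⟩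
  refine (((hba.mul_const M).add f.integrable.norm).add (f.integrable_pow_mul volume 1)).mono'
    (Measurable.aestronglyMeasurable (by have := f.continuous.measurable; fun_prop))
    (ae_of_all _ fun ξ => ?_)
  have h0 : 0 ≤ |ξ| ^ α := by positivity
  rw [norm_mul, Complex.norm_real, Real.norm_of_nonneg h0]
  simp only [Pi.add_apply, pow_one, Real.norm_eq_abs]
  rcases le_or_gt |ξ| 1 with h | h
  · have hbe : b |ξ| = |ξ| ^ α := indicator_of_mem (mem_Iic.2 h) _
    rw [hbe]
    have := mul_le_mul_of_nonneg_left (hM ξ) h0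
    have h3 : 0 ≤ |ξ| * ‖f ξ‖ := by positivity
    linarith [norm_nonneg (f ξ)]
  · have hbe : b |ξ| = 0 := indicator_of_notMem (by simpa using h) _
    rw [hbe]
    have h4 : |ξ| ^ α ≤ |ξ| := by
      simpa using rpow_le_rpow_of_exponent_le h.le h2
    have := mul_le_mul_of_nonneg_right h4 (norm_nonneg (f ξ))
    linarith [norm_nonneg (f ξ)]

lemma hasDerivAt_wave {a : ℝ → ℂ} (ha : Integrable a) (ham : Measurable a)
    (hsupp : ∀ ξ, a ξ ≠ 0 → |ξ| ≤ 1) (x t : ℝ) :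
    HasDerivAt (fun t => wave a x t) (wave (fun ξ => Complex.I * (ξ * |ξ| : ℝ) * a ξ) x t) t := by
  have hosc : ∀ ξ t, HasDerivAt (fun t => osc x t ξ) (osc x t ξ * (Complex.I * (ξ * |ξ| : ℝ))) t := by
    intro ξ t
    have h : HasDerivAt (fun t : ℝ => 2 * π * x * ξ + t * (ξ * |ξ|)) (ξ * |ξ|) t := by
      simpa using ((hasDerivAt_id t).mul_const (ξ * |ξ|)).const_add (2 * π * x * ξ)
    exact (h.ofReal_comp.const_mul Complex.I).cexp
  refine (hasDerivAt_integral_of_dominated_loc_of_deriv_le (bound := fun ξ => ‖a ξ‖)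
    (F' := fun t ξ => osc x t ξ * (Complex.I * (ξ * |ξ| : ℝ) * a ξ)) univ_mem
    (Eventually.of_forall fun t => (integrable_osc_mul ha x t).aestronglyMeasurable)
    (integrable_osc_mul ha x t) (Measurable.aestronglyMeasurable (by fun_prop))
    (ae_of_all _ fun ξ t _ => ?_) ha.norm (ae_of_all _ fun ξ t _ => ?_)).2
  · rw [norm_mul, norm_osc, one_mul, norm_mul, norm_mul, Complex.norm_I, one_mul,
      Complex.norm_real, Real.norm_eq_abs, abs_mul, abs_abs]
    by_cases h : a ξ = 0
    · simp [h]
    · exact mul_le_of_le_one_left (norm_nonneg _)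
        (mul_le_one₀ (hsupp ξ h) (abs_nonneg _) (hsupp ξ h))
  · simpa [mul_assoc] using (hosc ξ t).mul_const (a ξ)

lemma sq_lintegral_Ioc_le {F : ℝ → ℝ≥0∞} (hF : Measurable F) :
    (∫⁻ τ in Ioc (0 : ℝ) 1, F τ) ^ 2 ≤ ∫⁻ τ in Ioc (0 : ℝ) 1, F τ ^ 2 := by
  have h := ENNReal.lintegral_mul_le_Lp_mul_Lq (volume.restrict (Ioc (0 : ℝ) 1)) (p := 2) (q := 2)
    (Real.holderConjugate_iff.2 ⟨by norm_num, by norm_num⟩) hF.aemeasurable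
    (measurable_const (a := (1 : ℝ≥0∞))).aemeasurable
  simp only [Pi.mul_apply, mul_one, ENNReal.one_rpow, lintegral_const,
    Measure.restrict_apply_univ, Real.volume_Ioc, sub_zero, ENNReal.ofReal_one] at h
  have h2 := pow_le_pow_left' h 2
  rw [← ENNReal.rpow_natCast (_ ^ (1 / 2 : ℝ)), ← ENNReal.rpow_mul] at h2
  simpa using h2

/-- Maximal estimate for waves with low frequencies. -/
lemma exists_wave_maximal_of_low {a : ℝ → ℂ} (ha : Integrable a) (ham : Measurable a)
    (hsupp : ∀ ξ, a ξ ≠ 0 → |ξ| ≤ 1) :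
    ∃ S : ℝ → ℝ≥0∞, (∀ x, ∀ t ∈ Ioc (0 : ℝ) 1, ‖wave a x t‖ₑ ^ 2 ≤ S x) ∧
      ∫⁻ x, S x ≤ 8 * ∫⁻ ξ, ‖a ξ‖ₑ ^ 2 := by
  obtain ⟨b, hb⟩ : ∃ b : ℝ → ℂ, b = fun ξ => Complex.I * (ξ * |ξ| : ℝ) * a ξ := ⟨_, rfl⟩
  have hbm : Measurable b := by
    rw [hb]
    fun_prop
  have hba : ∀ ξ, ‖b ξ‖ ≤ ‖a ξ‖ := fun ξ => by
    rw [hb, norm_mul, norm_mul, Complex.norm_I, one_mul, Complex.norm_real, Real.norm_eq_abs,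
      abs_mul, abs_abs]
    by_cases h : a ξ = 0
    · simp [h]
    · exact mul_le_of_le_one_left (norm_nonneg _)
        (mul_le_one₀ (hsupp ξ h) (abs_nonneg _) (hsupp ξ h))
  have hbi : Integrable b := ha.norm.mono' hbm.aestronglyMeasurable (ae_of_all _ hba)
  have hd : ∀ x t, HasDerivAt (fun t => wave a x t) (wave b x t) t := fun x t => by
    rw [hb]
    exact hasDerivAt_wave ha ham hsupp x t
  have hcb := continuous_wave hbi
  have hcx : ∀ x, Continuous fun t => wave b x t := fun x =>
    hcb.comp (by fun_prop : Continuous fun t : ℝ => (x, t))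
  have hjm : Measurable fun p : ℝ × ℝ => ‖wave b p.1 p.2‖ₑ ^ 2 := hcb.measurable.enorm.pow_const 2
  refine ⟨fun x => 2 * ‖wave a x 0‖ₑ ^ 2 + 2 * ∫⁻ τ in Ioc (0 : ℝ) 1, ‖wave b x τ‖ₑ ^ 2,
    fun x t ht => ?_, ?_⟩
  · have h1 : wave a x t = wave a x 0 + ∫ τ in (0 : ℝ)..t, wave b x τ := by
      rw [intervalIntegral.integral_eq_sub_of_hasDerivAt (fun τ _ => hd x τ)
        ((hcx x).intervalIntegrable _ _)]
      ring
    have h2 : ‖∫ τ in (0 : ℝ)..t, wave b x τ‖ₑ ≤ ∫⁻ τ in Ioc (0 : ℝ) 1, ‖wave b x τ‖ₑ := by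
      rw [intervalIntegral.integral_of_le ht.1.le]
      exact (enorm_integral_le_lintegral_enorm _).trans
        (lintegral_mono_set (Ioc_subset_Ioc_right ht.2))
    have h3 : ∀ p q : ℝ≥0∞, (p + q) ^ 2 ≤ 2 * p ^ 2 + 2 * q ^ 2 := fun p q => by
      have h := ENNReal.rpow_add_le_mul_rpow_add_rpow p q one_le_two
      norm_num at h
      rwa [mul_add] at h
    rw [h1]
    refine (pow_le_pow_left' ((enorm_add_le _ _).trans (add_le_add_right h2 _)) 2).trans
      ((h3 _ _).trans (add_le_add_right (mul_le_mul_right ?_ _) _))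
    exact sq_lintegral_Ioc_le (hcx x).measurable.enorm
  · have hm0 : Measurable fun x => ‖wave a x 0‖ₑ ^ 2 :=
      (measurable_wave ha measurable_const).enorm.pow_const 2
    rw [lintegral_add_left (hm0.const_mul 2), lintegral_const_mul _ hm0,
      lintegral_const_mul _ hjm.lintegral_prod_right',
      lintegral_lintegral_swap (f := fun x τ => ‖wave b x τ‖ₑ ^ 2) hjm.aemeasurable]
    have h4 : ∫⁻ τ in Ioc (0 : ℝ) 1, ∫⁻ x, ‖wave b x τ‖ₑ ^ 2 ≤ 2 * ∫⁻ ξ, ‖a ξ‖ₑ ^ 2 := by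
      calc _ ≤ ∫⁻ τ in Ioc (0 : ℝ) 1, 2 * ∫⁻ ξ, ‖a ξ‖ₑ ^ 2 := by
            refine lintegral_mono fun τ => (lintegral_wave_space_le hbi hbm τ).trans
              (mul_le_mul_right (lintegral_mono fun ξ => pow_le_pow_left' ?_ 2) 2)
            exact enorm_le_iff_norm_le.2 (hba ξ)
        _ = _ := by simp
    calc _ ≤ 2 * (2 * ∫⁻ ξ, ‖a ξ‖ₑ ^ 2) + 2 * (2 * ∫⁻ ξ, ‖a ξ‖ₑ ^ 2) :=
          add_le_add (mul_le_mul_right (lintegral_wave_space_le ha ham 0) 2)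
            (mul_le_mul_right h4 2)
      _ = _ := by ring

lemma lowSymbol_nonneg {η : ℝ → ℝ} (hη : IsLPBump η) (ξ : ℝ) : 0 ≤ lowSymbol η ξ :=
  tsum_nonneg fun j => by split_ifs; exacts [hη.nonneg _, le_rfl]

lemma abs_le_of_lowSymbol_ne_zero {η : ℝ → ℝ} (hη : IsLPBump η) {ξ : ℝ} (h : lowSymbol η ξ ≠ 0) :
    |ξ| ≤ 1 := by
  by_contra! hξ
  refine h ?_
  refine (tsum_congr fun j => ?_).trans tsum_zero
  split_ifs with hj
  · by_contra hne
    have h1 := (hη.support _ hne).2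
    have h2 : (4 : ℝ) ≤ 2 ^ (-j) :=
      le_trans (by norm_num) (zpow_le_zpow_right₀ (by norm_num) (by omega : (3 : ℤ) ≤ -j))
    rw [abs_mul, abs_of_pos (by positivity : (0 : ℝ) < 2 ^ (-j))] at h1
    nlinarith
  · rfl

lemma lowSymbol_le_one {η : ℝ → ℝ} (hη : IsLPBump η) (ξ : ℝ) : lowSymbol η ξ ≤ 1 := by
  rcases eq_or_ne ξ 0 with rfl | hξ
  · have h0 : η 0 = 0 := by
      by_contra h
      have := (hη.support 0 h).1
      norm_num at this
    simp [lowSymbol, h0]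
  · have hs : Summable fun j : ℤ => η ((2 : ℝ) ^ (-j) * ξ) := by
      by_contra h
      have := hη.partition ξ hξ
      rw [tsum_eq_zero_of_not_summable h] at this
      norm_num at this
    have hle : ∀ j : ℤ, (if j ≤ -3 then η ((2 : ℝ) ^ (-j) * ξ) else 0) ≤ η ((2 : ℝ) ^ (-j) * ξ) :=
      fun j => by split_ifs; exacts [le_rfl, hη.nonneg _]
    rw [← hη.partition ξ hξ]
    refine Summable.tsum_le_tsum hle (hs.of_nonneg_of_le (fun j => ?_) hle) hs
    split_ifs
    exacts [hη.nonneg _, le_rfl]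

lemma measurable_lowSymbol {η : ℝ → ℝ} (hη : IsLPBump η) : Measurable (lowSymbol η) := by
  have h : lowSymbol η = fun ξ => (∑' j : ℤ,
      ENNReal.ofReal (if j ≤ -3 then η ((2 : ℝ) ^ (-j) * ξ) else 0)).toReal := by
    funext ξ
    rw [ENNReal.tsum_toReal_eq fun _ => ENNReal.ofReal_ne_top, lowSymbol]
    congr 1
    funext j
    rw [ENNReal.toReal_ofReal]
    split_ifs
    exacts [hη.nonneg _, le_rfl]
  rw [h]
  refine (Measurable.tsum fun j => ENNReal.measurable_ofReal.comp ?_).ennreal_toReal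
  split_ifs
  · exact hη.smooth.continuous.measurable.comp (by fun_prop)
  · exact measurable_const

lemma enorm_toReal_le_self (a : ℝ≥0∞) : ‖a.toReal‖ₑ ≤ a := by
  rw [Real.enorm_of_nonneg ENNReal.toReal_nonneg]
  exact ENNReal.ofReal_toReal_le

lemma LpLq_top_right_le {p : ℕ} (hp : p ≠ 0) {T : ℝ} {u : ℝ → ℝ → ℂ} {S : ℝ → ℝ≥0∞}
    (h : ∀ x, ∀ t ∈ Ioc (0 : ℝ) T, ‖u x t‖ₑ ^ p ≤ S x) :
    LpLq p ∞ T u ≤ (∫⁻ x, S x) ^ (1 / p : ℝ) := by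
  have hp0 : (0 : ℝ) < p := by exact_mod_cast Nat.pos_of_ne_zero hp
  rw [LpLq, eLpNorm_eq_lintegral_rpow_enorm_toReal (by exact_mod_cast hp) (by simp)]
  simp only [ENNReal.toReal_natCast]
  refine ENNReal.rpow_le_rpow (lintegral_mono fun x => ?_) (by positivity)
  have hx : eLpNorm (fun t => u x t) ∞ (volume.restrict (Ioc (0 : ℝ) T)) ≤ S x ^ (1 / p : ℝ) := by
    rw [eLpNorm_exponent_top]
    refine eLpNormEssSup_le_of_ae_enorm_bound ?_
    filter_upwards [ae_restrict_mem measurableSet_Ioc] with t ht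
    rw [one_div, ENNReal.le_rpow_inv_iff hp0, ENNReal.rpow_natCast]
    exact h x t ht
  have h1 := ENNReal.rpow_le_rpow ((enorm_toReal_le_self _).trans hx) hp0.le
  rwa [← ENNReal.rpow_mul, one_div, inv_mul_cancel₀ hp0.ne', ENNReal.rpow_one] at h1

lemma LpLq_top_two_le {T : ℝ} {u : ℝ → ℝ → ℂ} {B : ℝ≥0∞}
    (h : ∀ x, ∫⁻ t in Ioc (0 : ℝ) T, ‖u x t‖ₑ ^ 2 ≤ B) : LpLq ∞ 2 T u ≤ B ^ (1 / 2 : ℝ) := by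
  rw [LpLq, eLpNorm_exponent_top]
  refine eLpNormEssSup_le_of_ae_enorm_bound (ae_of_all _ fun x => (enorm_toReal_le_self _).trans ?_)
  rw [eLpNorm_eq_lintegral_rpow_enorm_toReal (by simp) (by simp)]
  simp only [ENNReal.toReal_ofNat, ENNReal.rpow_ofNat]
  exact ENNReal.rpow_le_rpow (h x) (by norm_num)

lemma LinfHs_le {s T : ℝ} {u : ℝ → ℝ → ℂ} {B : ℝ≥0∞} (h : ∀ t, HsNorm s (fun x => u x t) ≤ B) :
    LinfHs s T u ≤ B := by
  rw [LinfHs, eLpNorm_exponent_top]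
  exact eLpNormEssSup_le_of_ae_enorm_bound (ae_of_all _ fun t => (enorm_toReal_le_self _).trans (h t))

/-- The square of the `H^s` norm of a function with Fourier transform `f`. -/
def hsEnergy (s : ℝ) (f : ℝ → ℂ) : ℝ≥0∞ :=
  ∫⁻ ξ, ‖(((1 + ξ ^ 2) ^ (s / 2) : ℝ) : ℂ) * f ξ‖ₑ ^ 2

lemma HsNorm_eq (s : ℝ) (φ : SchwartzMap ℝ ℂ) :
    HsNorm s φ = hsEnergy s (𝓕 φ : SchwartzMap ℝ ℂ) ^ (1 / 2 : ℝ) := by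
  rw [HsNorm, hsEnergy, eLpNorm_eq_lintegral_rpow_enorm_toReal (by simp) (by simp),
    SchwartzMap.fourier_coe]
  simp only [ENNReal.toReal_ofNat, ENNReal.rpow_ofNat]

lemma enorm_complex_ofReal {r : ℝ} (hr : 0 ≤ r) : ‖(r : ℂ)‖ₑ = ENNReal.ofReal r := by
  rw [← ofReal_norm, Complex.norm_real, Real.norm_of_nonneg hr]

lemma lintegral_le_hsEnergy {s : ℝ} {f : ℝ → ℂ} {g : ℝ → ℝ≥0∞} {w : ℝ → ℝ}
    (hw : ∀ ξ, w ξ ≤ (1 + ξ ^ 2) ^ (s / 2))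
    (hg : ∀ ξ, g ξ ≤ (ENNReal.ofReal (w ξ) * ‖f ξ‖ₑ) ^ 2) :
    ∫⁻ ξ, g ξ ≤ hsEnergy s f := by
  refine lintegral_mono fun ξ => (hg ξ).trans (pow_le_pow_left' ?_ 2)
  rw [enorm_mul, enorm_complex_ofReal (by positivity)]
  exact mul_le_mul_left (ENNReal.ofReal_le_ofReal (hw ξ)) _

lemma abs_rpow_le_weight {s : ℝ} (hs : 0 ≤ s) (ξ : ℝ) : |ξ| ^ s ≤ (1 + ξ ^ 2) ^ (s / 2) := by
  have h : |ξ| ^ s = (ξ ^ 2) ^ (s / 2) := by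
    rw [← sq_abs, ← rpow_natCast, ← rpow_mul (abs_nonneg ξ)]
    congr 1
    push_cast
    ring
  rw [h]
  exact rpow_le_rpow (by positivity) (by linarith) (by positivity)

lemma one_le_weight {s : ℝ} (hs : 0 ≤ s) (ξ : ℝ) : 1 ≤ (1 + ξ ^ 2) ^ (s / 2) :=
  one_le_rpow (by nlinarith [sq_nonneg ξ]) (by positivity)

lemma LpLq_smoothing_le {s T : ℝ} (hs0 : 0 < s) (hs : s < 1 / 2) (hT : T < 1)
    (φ : SchwartzMap ℝ ℂ) :
    LpLq ∞ 2 T (sliceOp (Dop (s + 1 / 2)) fun x t => BOGroup t φ x)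
      ≤ ENNReal.ofReal (rexp 1 * (4 * π)) ^ (1 / 2 : ℝ) * HsNorm s φ := by
  rw [HsNorm_eq, ← ENNReal.mul_rpow_of_nonneg _ _ (by norm_num)]
  refine LpLq_top_two_le fun x => ?_
  simp only [sliceOp, Dop, FMul_BOGroup]
  set f : SchwartzMap ℝ ℂ := 𝓕 φ
  have hf := f.continuous.measurable
  refine (lintegral_wave_time_le (integrable_abs_rpow_mul (by linarith) (by linarith) f)
    (m := fun ξ => ENNReal.ofReal (|ξ| ^ s) * ‖f ξ‖ₑ) (by fun_prop) (fun ξ => ?_) x hT.le).trans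
    (mul_le_mul_right (lintegral_le_hsEnergy (abs_rpow_le_weight hs0.le) fun ξ => le_rfl) _)
  rw [enorm_mul, enorm_complex_ofReal (by positivity), ← mul_assoc,
    ENNReal.ofReal_rpow_of_nonneg (abs_nonneg ξ) (by norm_num),
    ← ENNReal.ofReal_mul (by positivity), ← rpow_add_of_nonneg (abs_nonneg ξ) (by norm_num) hs0.le,
    add_comm]

lemma LpLq_maximal_le {s T : ℝ} (hs0 : 0 < s) (hs : s < 1 / 2) (φ : SchwartzMap ℝ ℂ) :
    LpLq 4 ∞ T (sliceOp (Dop (s - 1 / 4)) fun x t => BOGroup t φ x)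
      ≤ dualConst ^ (1 / 2 : ℝ) * HsNorm s φ := by
  rw [HsNorm_eq, ← ENNReal.mul_rpow_of_nonneg _ _ (by norm_num)]
  set f : SchwartzMap ℝ ℂ := 𝓕 φ with hfdef
  have hf := f.continuous.measurable
  obtain ⟨S, hS, hSi⟩ := exists_wave_maximal
    (integrable_abs_rpow_mul (α := s - 1 / 4) (by linarith) (by linarith) f) (by fun_prop)
  have h := LpLq_top_right_le (p := 4) (by norm_num) (T := T)
    (u := sliceOp (Dop (s - 1 / 4)) fun x t => BOGroup t φ x) (S := S) fun x t _ => by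
      simp only [sliceOp, Dop, FMul_BOGroup]
      exact hS x t
  refine h.trans ?_
  have h2 : ∫⁻ ξ, ENNReal.ofReal |ξ| ^ (1 / 2 : ℝ) * ‖((|ξ| ^ (s - 1 / 4) : ℝ) : ℂ) * f ξ‖ₑ ^ 2
      ≤ hsEnergy s f := by
    refine lintegral_le_hsEnergy (abs_rpow_le_weight hs0.le) fun ξ => ?_
    rw [enorm_mul, enorm_complex_ofReal (by positivity), mul_pow, mul_pow, ← mul_assoc,
      ENNReal.ofReal_rpow_of_nonneg (abs_nonneg ξ) (by norm_num),
      ← ENNReal.ofReal_pow (by positivity), ← ENNReal.ofReal_pow (by positivity),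
      ← ENNReal.ofReal_mul (by positivity)]
    refine mul_le_mul_left (ENNReal.ofReal_le_ofReal ?_) _
    rcases eq_or_ne ξ 0 with rfl | hξ
    · rw [abs_zero, zero_rpow (by norm_num : (1 / 2 : ℝ) ≠ 0), zero_mul]
      positivity
    · have hpos : 0 < |ξ| := abs_pos.2 hξ
      rw [sq, sq, ← rpow_add hpos, ← rpow_add hpos, ← rpow_add hpos]
      refine le_of_eq ?_
      congr 1
      ring
  calc (∫⁻ x, S x) ^ (1 / (4 : ℕ) : ℝ) ≤ ((hsEnergy s f * dualConst) ^ 2) ^ (1 / (4 : ℕ) : ℝ) :=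
        ENNReal.rpow_le_rpow (hSi.trans (pow_le_pow_left' (mul_le_mul_left h2 _) 2)) (by norm_num)
    _ = _ := by
        rw [← ENNReal.rpow_natCast, ← ENNReal.rpow_mul, mul_comm]
        norm_num

lemma LpLq_low_le {η : ℝ → ℝ} (hη : IsLPBump η) {s T : ℝ} (hs0 : 0 < s) (hT : T < 1)
    (φ : SchwartzMap ℝ ℂ) :
    LpLq 2 ∞ T (sliceOp (P0 η) fun x t => BOGroup t φ x) ≤ 8 ^ (1 / 2 : ℝ) * HsNorm s φ := by
  rw [HsNorm_eq, ← ENNReal.mul_rpow_of_nonneg _ _ (by norm_num)]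
  set f : SchwartzMap ℝ ℂ := 𝓕 φ with hfdef
  have hf := f.continuous.measurable
  have hlm := measurable_lowSymbol hη
  have hle : ∀ ξ, ‖((lowSymbol η ξ : ℝ) : ℂ) * f ξ‖ ≤ ‖f ξ‖ := fun ξ => by
    rw [norm_mul, Complex.norm_real, Real.norm_of_nonneg (lowSymbol_nonneg hη ξ)]
    exact mul_le_of_le_one_left (norm_nonneg _) (lowSymbol_le_one hη ξ)
  have hm : Measurable fun ξ => ((lowSymbol η ξ : ℝ) : ℂ) * f ξ := by fun_prop
  obtain ⟨S, hS, hSi⟩ := exists_wave_maximal_of_low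
    (f.integrable.norm.mono' hm.aestronglyMeasurable (ae_of_all _ hle)) hm fun ξ hξ =>
      abs_le_of_lowSymbol_ne_zero hη fun h0 => hξ (by simp [h0])
  have h := LpLq_top_right_le (p := 2) (by norm_num) (T := T)
    (u := sliceOp (P0 η) fun x t => BOGroup t φ x) (S := S) fun x t ht => by
      simp only [sliceOp, P0, FMul_BOGroup]
      exact hS x t ⟨ht.1, ht.2.trans hT.le⟩
  refine h.trans (ENNReal.rpow_le_rpow (hSi.trans (mul_le_mul_right ?_ _)) (by norm_num))
  refine lintegral_le_hsEnergy (one_le_weight hs0.le) fun ξ => pow_le_pow_left' ?_ 2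
  rw [ENNReal.ofReal_one, one_mul]
  exact enorm_le_iff_norm_le.2 (hle ξ)

/-- For `0 < s < 1/2`, every `φ ∈ 𝒮(ℝ)` and every `0 < T < 1`, the free
evolution satisfies `‖V(t)φ‖_{X^s_T} ≲ ‖φ‖_{H^s}`, with implicit constant
depending only on `s`. -/
theorem free_evolution_in_XsT (η : ℝ → ℝ) (hη : IsLPBump η)
    (s : ℝ) (hs0 : 0 < s) (hs : s < 1/2) :
    ∃ C : ℝ≥0, 0 < C ∧ ∀ (φ : SchwartzMap ℝ ℂ) (T : ℝ), 0 < T → T < 1 →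
      XNorm η s T (fun x t => BOGroup t ⇑φ x) ≤ C * HsNorm s ⇑φ := by
  obtain ⟨K, hK⟩ : ∃ K : ℝ≥0∞, K = 1 + ENNReal.ofReal (rexp 1 * (4 * π)) ^ (1 / 2 : ℝ) +
    dualConst ^ (1 / 2 : ℝ) + 8 ^ (1 / 2 : ℝ) := ⟨_, rfl⟩
  have hd : dualConst ≠ ∞ := by
    unfold dualConst
    finiteness
  have hKtop : K ≠ ∞ := by
    rw [hK]
    finiteness
  have hKpos : K ≠ 0 := by
    rw [hK]
    simp
  refine ⟨K.toNNReal, ENNReal.toNNReal_pos hKpos hKtop, fun φ T _ hT => ?_⟩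
  rw [ENNReal.coe_toNNReal hKtop, hK, add_mul, add_mul, add_mul, one_mul, XNorm]
  exact add_le_add (add_le_add (add_le_add (LinfHs_le fun t => (HsNorm_BOGroup φ s t).le)
    (LpLq_smoothing_le hs0 hs hT φ)) (LpLq_maximal_le hs0 hs φ)) (LpLq_low_le hη hs0 hT φ)

end
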